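/- Let (X, ν, d) and (Y, μ, d') be computable metric spaces* and let f : X → Y be a (ν,μ)-computable function. Then f is formally effectively metric continuous if and only if f is effectively continuous with respect to the Spreen topologies induced by the metrics on X and Y, i.e. the Spreen topologies generated by the open balls centered at computable points with computable radii, viewed as Spreen bases with their natural formal inclusion relations. -/

import Mathlib

namespace T1

/-- `phi e` : the `e`-th partial computable function `ℕ ⇀ ℕ`. -/
def phi (e : ℕ) : ℕ →. ℕ :=
  Nat.Partrec.Code.eval (Denumerable.ofNat Nat.Partrec.Code e)

/-- `W e` : the `e`-th computably enumerable subset of `ℕ`. -/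
def W (e : ℕ) : Set ℕ := (phi e).Dom

/-- A canonical numbering of the rationals. -/
def ratOfNat (k : ℕ) : ℚ := (Encodable.decode (α := ℚ) k).getD 0

/-- `e` is a name of `A ⊆ X` as a `ν`-semi-decidable set (a `ν_SD,m`-name):
`phi e` halts on a `ν`-name exactly when the named point belongs to `A`. -/
def SemiDecName {X : Type*} (ν : ℕ →. X) (A : Set X) (e : ℕ) : Prop :=
  ∀ i x, x ∈ ν i → ((phi e i).Dom ↔ x ∈ A)

/-- `f : X → Y` is `(ν,μ)`-computable. -/
def Computes {X Y : Type*} (ν : ℕ →. X) (μ : ℕ →. Y) (f : X → Y) : Prop :=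
  ∃ F : ℕ →. ℕ, Nat.Partrec F ∧ ∀ n x, x ∈ ν n → ∃ m ∈ F n, f x ∈ μ m

/-- `r` is a formal inclusion relation for the naming relation `β` of a family of
subsets of `X`: reflexive (on names), transitive, and implying actual inclusion. -/
structure IsFormalIncl {X : Type*} (β : ℕ → Set X → Prop) (r : ℕ → ℕ → Prop) : Prop where
  refl : ∀ n A, β n A → r n n
  trans : ∀ a b c, r a b → r b c → r a c
  mono : ∀ n m A B, r n m → β n A → β m B → A ⊆ B

/-- Extension of a formal inclusion relation: a name vs. a sequence of names. -/
def SeqIncl (r : ℕ → ℕ → Prop) (b : ℕ) (s : ℕ → ℕ) : Prop := ∃ k, r b (s k)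

/-- Extension of a formal inclusion relation: sequence vs. sequence. -/
def SeqIncl₂ (r : ℕ → ℕ → Prop) (s t : ℕ → ℕ) : Prop := ∀ p, SeqIncl r (s p) t

/-- The equivalence induced by the extended formal inclusion on sequences. -/
def SeqEquiv (r : ℕ → ℕ → Prop) (s t : ℕ → ℕ) : Prop := SeqIncl₂ r s t ∧ SeqIncl₂ r t s

/-- A Type 1 computable topological space `(X, ν, T, τ, r)`, where `τ` is a
(single-valued) naming relation for open sets and `r` a formal inclusion relation. -/
structure IsCTS {X : Type*} (ν : ℕ →. X) (T : TopologicalSpace X)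
    (τ : ℕ → Set X → Prop) (r : ℕ → ℕ → Prop) : Prop where
  single : ∀ n A B, τ n A → τ n B → A = B
  formal : IsFormalIncl τ r
  isOpen : ∀ n A, τ n A → T.IsOpen A
  generates : T = TopologicalSpace.generateFrom {A | ∃ n, τ n A}
  empty : ∃ n, τ n (∅ : Set X)
  univ : ∃ n, τ n (Set.univ : Set X)
  malcev : ∃ F : ℕ →. ℕ, Nat.Partrec F ∧ ∀ n A, τ n A → ∃ e ∈ F n, SemiDecName ν A e
  union : ∃ U : ℕ →. ℕ, Nat.Partrec U ∧
    (∀ c (s : ℕ → ℕ) (A : ℕ → Set X), (∀ k, s k ∈ phi c k) → (∀ k, τ (s k) (A k)) →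
      ∃ u ∈ U c, τ u (⋃ k, A k) ∧ ∀ k, r (s k) u) ∧
    (∀ c (s : ℕ → ℕ) (A : ℕ → Set X) c' (s' : ℕ → ℕ) (A' : ℕ → Set X),
      (∀ k, s k ∈ phi c k) → (∀ k, τ (s k) (A k)) →
      (∀ k, s' k ∈ phi c' k) → (∀ k, τ (s' k) (A' k)) →
      (∀ p, SeqIncl r (s p) s') →
      ∀ u ∈ U c, ∀ u' ∈ U c', r u u')
  inter : ∃ I : ℕ →. ℕ, Nat.Partrec I ∧
    (∀ n₁ n₂ A₁ A₂, τ n₁ A₁ → τ n₂ A₂ → ∃ u ∈ I (Nat.pair n₁ n₂), τ u (A₁ ∩ A₂)) ∧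
    (∀ n₁ n₂ A₁ A₂ n₁' n₂' A₁' A₂', τ n₁ A₁ → τ n₂ A₂ → τ n₁' A₁' → τ n₂' A₂' →
      r n₁ n₁' → r n₂ n₂' →
      ∀ u ∈ I (Nat.pair n₁ n₂), ∀ u' ∈ I (Nat.pair n₁' n₂'), r u u')

/-- A Type 1 computable topological space with the actual inclusion relation as
formal inclusion (all monotonicity requirements are then automatic and omitted). -/
structure IsCTSIncl {X : Type*} (ν : ℕ →. X) (T : TopologicalSpace X)
    (τ : ℕ → Set X → Prop) : Prop where
  single : ∀ n A B, τ n A → τ n B → A = B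
  isOpen : ∀ n A, τ n A → T.IsOpen A
  generates : T = TopologicalSpace.generateFrom {A | ∃ n, τ n A}
  empty : ∃ n, τ n (∅ : Set X)
  univ : ∃ n, τ n (Set.univ : Set X)
  malcev : ∃ F : ℕ →. ℕ, Nat.Partrec F ∧ ∀ n A, τ n A → ∃ e ∈ F n, SemiDecName ν A e
  union : ∃ U : ℕ →. ℕ, Nat.Partrec U ∧
    ∀ c (s : ℕ → ℕ) (A : ℕ → Set X), (∀ k, s k ∈ phi c k) → (∀ k, τ (s k) (A k)) →
      ∃ u ∈ U c, τ u (⋃ k, A k)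
  inter : ∃ I : ℕ →. ℕ, Nat.Partrec I ∧
    ∀ n₁ n₂ A₁ A₂, τ n₁ A₁ → τ n₂ A₂ → ∃ u ∈ I (Nat.pair n₁ n₂), τ u (A₁ ∩ A₂)

/-- A Nogina basis for `(X, ν)` (with `ν` intended to be a numbering, i.e. onto). -/
structure IsNoginaBasis {X : Type*} (ν : ℕ →. X) (β : ℕ → Set X → Prop) : Prop where
  single : ∀ b B B', β b B → β b B' → B = B'
  semidec : ∃ F : ℕ →. ℕ, Nat.Partrec F ∧ ∀ b B, β b B → ∃ e ∈ F b, SemiDecName ν B e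
  point : ∃ G : ℕ →. ℕ, Nat.Partrec G ∧
    ∀ n x, x ∈ ν n → ∃ b ∈ G n, ∃ B, β b B ∧ x ∈ B
  inter : ∃ H : ℕ →. ℕ, Nat.Partrec H ∧
    ∀ b₁ b₂ B₁ B₂ n x, β b₁ B₁ → β b₂ B₂ → x ∈ ν n → x ∈ B₁ → x ∈ B₂ →
      ∃ b₃ ∈ H (Nat.pair (Nat.pair b₁ b₂) n), ∃ B₃, β b₃ B₃ ∧ x ∈ B₃ ∧ B₃ ⊆ B₁ ∩ B₂

/-- `p = ⟨e₁, e₂⟩` is a name of the open set `O` for the Nogina topology of the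
basis `β`: `e₁` witnesses semi-decidability of `O` and `e₂` computes, from a
`ν`-name of a point of `O`, a basic set containing the point and contained in `O`. -/
def NoginaName {X : Type*} (ν : ℕ →. X) (β : ℕ → Set X → Prop) (p : ℕ) (O : Set X) : Prop :=
  SemiDecName ν O p.unpair.1 ∧
  ∀ n x, x ∈ ν n → x ∈ O → ∃ b ∈ phi p.unpair.2 n, ∃ B, β b B ∧ x ∈ B ∧ B ⊆ O

/-- `i` is a name of `O` as a Lacombe set: `W i ⊆ dom β` and `O` is the union of
the basic sets named by elements of `W i`. -/
def LacombeName {X : Type*} (β : ℕ → Set X → Prop) (i : ℕ) (O : Set X) : Prop :=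
  (∀ k ∈ W i, ∃ B, β k B) ∧ O = ⋃ k ∈ W i, ⋃ B, ⋃ (_ : β k B), B

/-- A Lacombe basis for `(X, ν)`. -/
structure IsLacombeBasis {X : Type*} (ν : ℕ →. X) (β : ℕ → Set X → Prop) : Prop where
  single : ∀ b B B', β b B → β b B' → B = B'
  semidec : ∃ F : ℕ →. ℕ, Nat.Partrec F ∧ ∀ b B, β b B → ∃ e ∈ F b, SemiDecName ν B e
  point : ∀ x : X, ∃ b B, β b B ∧ x ∈ B
  cover : ∃ i, LacombeName β i (Set.univ : Set X)
  inter : ∃ H : ℕ →. ℕ, Nat.Partrec H ∧ ∀ b₁ b₂ B₁ B₂, β b₁ B₁ → β b₂ B₂ →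
    ∃ i ∈ H (Nat.pair b₁ b₂), LacombeName β i (B₁ ∩ B₂)

/-- A Spreen basis for `(X, ν)`, with formal inclusion relation `r`.  Computable
functions with values in `dom(β)^ℕ` are represented by partial computable
functions producing the `k`-th term of the sequence from the pair `⟨input, k⟩`. -/
structure IsSpreenBasis {X : Type*} (ν : ℕ →. X) (β : ℕ → Set X → Prop)
    (r : ℕ → ℕ → Prop) : Prop where
  single : ∀ b B B', β b B → β b B' → B = B'
  formal : IsFormalIncl β r
  semidec : ∃ F : ℕ →. ℕ, Nat.Partrec F ∧ ∀ b B, β b B → ∃ e ∈ F b, SemiDecName ν B e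
  dense : ∀ b B, β b B → B.Nonempty → ∃ n x, x ∈ ν n ∧ x ∈ B
  G1 : ∃ g : ℕ →. ℕ, Nat.Partrec g ∧
    (∀ n x, x ∈ ν n → ∃ s : ℕ → ℕ, (∀ k, s k ∈ g (Nat.pair n k)) ∧
      ∀ k, ∃ B, β (s k) B ∧ x ∈ B) ∧
    (∀ n m x (s t : ℕ → ℕ), x ∈ ν n → x ∈ ν m →
      (∀ k, s k ∈ g (Nat.pair n k)) → (∀ k, t k ∈ g (Nat.pair m k)) → SeqEquiv r s t) ∧
    (∀ x : X, ∃ b B, β b B ∧ x ∈ B ∧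
      ∀ n y, y ∈ ν n → y ∈ B → ∀ s : ℕ → ℕ, (∀ k, s k ∈ g (Nat.pair n k)) → SeqIncl r b s)
  G2 : ∃ g : ℕ →. ℕ, Nat.Partrec g ∧
    (∀ n x b₁ b₂ B₁ B₂, x ∈ ν n → β b₁ B₁ → β b₂ B₂ → x ∈ B₁ → x ∈ B₂ →
      ∃ s : ℕ → ℕ, (∀ k, s k ∈ g (Nat.pair (Nat.pair n (Nat.pair b₁ b₂)) k)) ∧
        ∀ k, ∃ B, β (s k) B ∧ x ∈ B ∧ B ⊆ B₁ ∩ B₂) ∧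
    (∀ n m x b₁ b₂ b₁' b₂' (s t : ℕ → ℕ), x ∈ ν n → x ∈ ν m → r b₁ b₁' → r b₂ b₂' →
      (∀ k, s k ∈ g (Nat.pair (Nat.pair n (Nat.pair b₁ b₂)) k)) →
      (∀ k, t k ∈ g (Nat.pair (Nat.pair m (Nat.pair b₁' b₂')) k)) → SeqIncl₂ r s t) ∧
    (∀ b₁ b₂ B₁ B₂, β b₁ B₁ → β b₂ B₂ → ∀ x, x ∈ B₁ → x ∈ B₂ →
      ∃ b₃ B₃, β b₃ B₃ ∧ x ∈ B₃ ∧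
        ∀ m y, y ∈ ν m → y ∈ B₃ → ∀ s : ℕ → ℕ,
          (∀ k, s k ∈ g (Nat.pair (Nat.pair m (Nat.pair b₁ b₂)) k)) → SeqIncl r b₃ s)

/-- `p = ⟨n, m⟩` is a name of the open set `O` for the Spreen topology of the
Spreen basis `(β, r)`. -/
def SpreenName {X : Type*} (ν : ℕ →. X) (β : ℕ → Set X → Prop) (r : ℕ → ℕ → Prop)
    (p : ℕ) (O : Set X) : Prop :=
  SemiDecName ν O p.unpair.1 ∧
  (∀ n x, x ∈ ν n → x ∈ O → ∃ s : ℕ → ℕ,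
      (∀ k, s k ∈ phi p.unpair.2 (Nat.pair n k)) ∧
      ∀ k, ∃ B, β (s k) B ∧ x ∈ B ∧ B ⊆ O) ∧
  (∀ n m x (s t : ℕ → ℕ), x ∈ ν n → x ∈ ν m → x ∈ O →
      (∀ k, s k ∈ phi p.unpair.2 (Nat.pair n k)) →
      (∀ k, t k ∈ phi p.unpair.2 (Nat.pair m k)) → SeqEquiv r s t) ∧
  (∀ x, x ∈ O → ∃ b B, β b B ∧ x ∈ B ∧
      ∀ n y, y ∈ ν n → y ∈ B → ∀ s : ℕ → ℕ,
        (∀ k, s k ∈ phi p.unpair.2 (Nat.pair n k)) → SeqIncl r b s)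

/-- The extension of the formal inclusion relation `r` to names of Spreen open sets. -/
def SpreenTauIncl {X : Type*} (ν : ℕ →. X) (r : ℕ → ℕ → Prop) (p q : ℕ) : Prop :=
  ∀ n ∈ ν.Dom, (phi p.unpair.1 n).Dom →
    (phi q.unpair.1 n).Dom ∧
    ∀ s t : ℕ → ℕ, (∀ k, s k ∈ phi p.unpair.2 (Nat.pair n k)) →
      (∀ k, t k ∈ phi q.unpair.2 (Nat.pair n k)) → SeqIncl₂ r s t

/-- A partial computable translation of Spreen names of open sets for the basis
`(β₁, r₁)` into Spreen names for the basis `(β₂, r₂)`, increasing with respect to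
the extended formal inclusion relations. -/
def SpreenTopTrans {X : Type*} (ν : ℕ →. X) (β₁ : ℕ → Set X → Prop) (r₁ : ℕ → ℕ → Prop)
    (β₂ : ℕ → Set X → Prop) (r₂ : ℕ → ℕ → Prop) : Prop :=
  ∃ h : ℕ →. ℕ, Nat.Partrec h ∧
    (∀ p O, SpreenName ν β₁ r₁ p O → ∃ q ∈ h p, SpreenName ν β₂ r₂ q O) ∧
    (∀ p p' O O', SpreenName ν β₁ r₁ p O → SpreenName ν β₁ r₁ p' O' →
      SpreenTauIncl ν r₁ p p' → ∀ q ∈ h p, ∀ q' ∈ h p', SpreenTauIncl ν r₂ q q')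

/-- Effective continuity between computable topological spaces, with the actual
inclusion relations as formal inclusions. -/
def EffContinuous {X Y : Type*} (T₁ : TopologicalSpace X) (T₂ : TopologicalSpace Y)
    (τ₁ : ℕ → Set X → Prop) (τ₂ : ℕ → Set Y → Prop) (f : X → Y) : Prop :=
  (@Continuous X Y T₁ T₂ f) ∧
  ∃ h : ℕ →. ℕ, Nat.Partrec h ∧ ∀ n O, τ₂ n O → ∃ m ∈ h n, τ₁ m (f ⁻¹' O)

/-- Effective continuity between computable topological spaces with formal
inclusion relations `r₁`, `r₂` on names of open sets. -/
def EffContinuousF {X Y : Type*} (T₁ : TopologicalSpace X) (T₂ : TopologicalSpace Y)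
    (τ₁ : ℕ → Set X → Prop) (τ₂ : ℕ → Set Y → Prop)
    (r₁ r₂ : ℕ → ℕ → Prop) (f : X → Y) : Prop :=
  (@Continuous X Y T₁ T₂ f) ∧
  ∃ h : ℕ →. ℕ, Nat.Partrec h ∧
    (∀ n O, τ₂ n O → ∃ m ∈ h n, τ₁ m (f ⁻¹' O)) ∧
    (∀ n₁ n₂ O₁ O₂, τ₂ n₁ O₁ → τ₂ n₂ O₂ → r₂ n₁ n₂ →
      ∀ m₁ ∈ h n₁, ∀ m₂ ∈ h n₂, r₁ m₁ m₂)

/-- `e` is a Cauchy name (`c_ℝ`-name) of the real number `x`. -/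
def CRealName (e : ℕ) (x : ℝ) : Prop :=
  ∀ n : ℕ, ∃ m ∈ phi e n, |((ratOfNat m : ℚ) : ℝ) - x| < (2 : ℝ) ^ (-(n : ℤ))

/-- `e` is a left (lower) name (`c_↗`-name) of the real number `x`: it computes a
nondecreasing sequence of rationals below `x` converging to `x`. -/
def LRealName (e : ℕ) (x : ℝ) : Prop :=
  ∃ s : ℕ → ℕ, (∀ n, s n ∈ phi e n) ∧
    (Monotone fun n => ratOfNat (s n)) ∧
    (∀ n, ((ratOfNat (s n) : ℚ) : ℝ) < x) ∧
    Filter.Tendsto (fun n => ((ratOfNat (s n) : ℚ) : ℝ)) Filter.atTop (nhds x)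

/-- `(X, ν, d)` is a (non-necessarily effectively separable) computable metric
space: the computable points are dense and the metric is `(ν×ν, c_ℝ)`-computable. -/
structure IsCMS {X : Type*} [MetricSpace X] (ν : ℕ →. X) : Prop where
  dense : Dense {x : X | ∃ n, x ∈ ν n}
  dist_comp : ∃ F : ℕ →. ℕ, Nat.Partrec F ∧
    ∀ n m x y, x ∈ ν n → y ∈ ν m → ∃ e ∈ F (Nat.pair n m), CRealName e (dist x y)

/-- The natural numbering of the open balls of a computable metric space, centered
at computable points with computable radii: `⟨n, m⟩` names `B(ν n, c_ℝ m)`. -/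
def ballName {X : Type*} [MetricSpace X] (ν : ℕ →. X) (p : ℕ) (B : Set X) : Prop :=
  ∃ x r, x ∈ ν p.unpair.1 ∧ CRealName p.unpair.2 r ∧ B = Metric.ball x r

/-- The natural formal inclusion relation on names of balls:
`(x, r₁) ⊆̊ (y, r₂)` iff `d(x, y) + r₁ ≤ r₂`. -/
def ballIncl {X : Type*} [MetricSpace X] (ν : ℕ →. X) (p q : ℕ) : Prop :=
  ∃ x y r s, x ∈ ν p.unpair.1 ∧ y ∈ ν q.unpair.1 ∧
    CRealName p.unpair.2 r ∧ CRealName q.unpair.2 s ∧ dist x y + r ≤ s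

/-- `f` is effectively metric continuous: from a name of a point `x` and a name of
`ε > 0` one can compute a name of some `η > 0` witnessing continuity at `x`. -/
def EffMetricContinuous {X Y : Type*} [MetricSpace X] [MetricSpace Y]
    (ν : ℕ →. X) (f : X → Y) : Prop :=
  ∃ H : ℕ →. ℕ, Nat.Partrec H ∧
    ∀ n x e ε, x ∈ ν n → CRealName e ε → (0:ℝ) < ε →
      ∃ m ∈ H (Nat.pair n e), ∃ η : ℝ, CRealName m η ∧ 0 < η ∧
        ∀ y : X, dist x y < η → dist (f x) (f y) < ε

/-- `(X, ν, d)` admits an algorithm of passage to the limit. -/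
def HasLimitAlg {X : Type*} [MetricSpace X] (ν : ℕ →. X) : Prop :=
  ∃ L : ℕ →. ℕ, Nat.Partrec L ∧
    ∀ c (s : ℕ → ℕ) (xs : ℕ → X) (x : X),
      (∀ k, s k ∈ phi c k) → (∀ k, xs k ∈ ν (s k)) →
      (∀ k m, k < m → dist (xs k) (xs m) < (2 : ℝ) ^ (-(k : ℤ))) →
      Filter.Tendsto xs Filter.atTop (nhds x) →
      ∃ p ∈ L c, x ∈ ν p


/-- `f` is formally effectively metric continuous: there is a modulus of
continuity `φ`, assigning to each computable point `x` and each left computable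
`ε > 0` a positive real `φ x ε`, which is `(ν × c_↗, c_↗)`-computable (its value
depends only on `x` and `ε`, not on their names), satisfies the continuity
estimate, and does not vanish near any point of `X` (condition ⊙). -/
def FormalEffMetricCont {X Y : Type*} [MetricSpace X] [MetricSpace Y]
    (ν : ℕ →. X) (f : X → Y) : Prop :=
  ∃ φ : X → ℝ → ℝ,
    (∃ H : ℕ →. ℕ, Nat.Partrec H ∧ ∀ n x e ε, x ∈ ν n → LRealName e ε → (0:ℝ) < ε →
        ∃ m ∈ H (Nat.pair n e), LRealName m (φ x ε)) ∧
    (∀ x ε, (∃ n, x ∈ ν n) → (∃ e, LRealName e ε) → (0:ℝ) < ε → 0 < φ x ε) ∧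
    (∀ x y ε, (∃ n, x ∈ ν n) → (∃ e, LRealName e ε) → (0:ℝ) < ε →
        dist x y < φ x ε → dist (f x) (f y) < ε) ∧
    (∀ x : X, ∀ ε : ℝ, (∃ e, LRealName e ε) → (0:ℝ) < ε →
        ∃ r > (0:ℝ), ∀ y : X, dist x y < r → (∃ n, y ∈ ν n) → r ≤ φ y ε)
section Computability

variable {α : Type*} [Primcodable α]

theorem partrec_phi : Partrec₂ phi :=
  Nat.Partrec.Code.eval_part.comp ((Computable.ofNat _).comp Computable.fst) Computable.snd

/-- The s-m-n theorem for the numbering `phi`. -/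
theorem exists_phi_eq {g : α × ℕ →. ℕ} (hg : Partrec g) :
    ∃ c : α → ℕ, Computable c ∧ ∀ a n, phi (c a) n = g (a, n) := by
  obtain ⟨cd, hcd⟩ := Nat.Partrec.Code.exists_code.1 hg
  obtain ⟨S, hS, hSe⟩ := Nat.Partrec.Code.smn
  refine ⟨fun a => Encodable.encode (S cd (Encodable.encode a)),
    Computable.encode.comp (hS.comp (Computable.const cd) Computable.encode), fun a n => ?_⟩
  have h2 : Nat.pair (Encodable.encode a) n = Encodable.encode (a, n) := by simp
  simp only [phi]
  rw [Denumerable.ofNat_encode, hSe, hcd, h2]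
  simp [Encodable.encodek, Part.map_id']

/-- Given a partial computable test `V` that is total at `a` and returns `b + 1` to accept `b`,
one can enumerate the accepted values, as soon as there is at least one. -/
theorem exists_enum {V : α × ℕ →. ℕ} (hV : Partrec V) :
    ∃ S : α × ℕ →. ℕ, Partrec S ∧ ∀ a, (∀ t, (V (a, t)).Dom) →
      ((S (a, 0)).Dom ↔ ∃ t b, b + 1 ∈ V (a, t)) ∧
      ((∃ t b, b + 1 ∈ V (a, t)) →
        ∃ s : ℕ → ℕ, (∀ k, s k ∈ S (a, k)) ∧ ∀ b, (∃ k, s k = b) ↔ ∃ t, b + 1 ∈ V (a, t)) := by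
  let W : (α × ℕ) → ℕ →. ℕ := fun p t => V (p.1, (p.2 + t).unpair.1)
  have hadd : Computable fun p : (α × ℕ) × ℕ => p.1.2 + p.2 :=
    (Primrec.nat_add.to_comp).comp (Computable.snd.comp Computable.fst) Computable.snd
  have hW : Partrec₂ W :=
    hV.comp ((Computable.fst.comp Computable.fst).pair
      (Computable.fst.comp (Computable.unpair.comp hadd)))
  let T : (α × ℕ) → ℕ →. Bool := fun p t => (W p t).map fun v => decide (0 < v)
  have hT : Partrec₂ T := by
    refine Partrec.map hW ?_
    exact (Primrec.nat_lt.decide.comp (Primrec.const 0) Primrec.snd).to_comp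
  let S : α × ℕ →. ℕ := fun p => (Nat.rfind (T p)).bind fun t => (W p t).map Nat.pred
  have hS : Partrec S :=
    (Partrec.rfind hT).bind (hW.map (Computable.pred.comp Computable.snd))
  refine ⟨S, hS, fun a ha => ?_⟩
  choose v hv using fun t => Part.dom_iff_mem.1 (ha t)
  have hvm : ∀ t b, b ∈ V (a, t) ↔ b = v t := fun t b =>
    ⟨fun h => Part.mem_unique h (hv t), fun h => h ▸ hv t⟩
  have hTm : ∀ k t c, c ∈ T (a, k) t ↔ c = decide (0 < v (k + t).unpair.1) := by
    intro k t c
    simp only [T, W, Part.mem_map_iff, hvm, exists_eq_left]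
    exact eq_comm
  have hSm : ∀ k b, b ∈ S (a, k) →
      ∃ t, v (k + t).unpair.1 = b + 1 ∧ ∀ t' < t, v (k + t').unpair.1 = 0 := by
    intro k b hb
    simp only [S, Part.mem_bind_iff, Nat.mem_rfind, hTm, Part.mem_map_iff, W, hvm,
      exists_eq_left] at hb
    obtain ⟨t, ⟨h1, h2⟩, h3⟩ := hb
    refine ⟨t, ?_, fun t' ht' => ?_⟩
    · have : 0 < v (k + t).unpair.1 := by simpa using h1.symm
      rw [← h3]; exact (Nat.succ_pred_eq_of_pos this).symm
    · have := h2 ht'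
      simpa using this.symm
  have hSd : ∀ k t, 0 < v (k + t).unpair.1 → (S (a, k)).Dom := by
    intro k t ht
    have : (Nat.rfind (T (a, k))).Dom := by
      refine Nat.rfind_dom.2 ⟨t, (hTm _ _ _).2 (by simpa using ht), fun {m} _ => ?_⟩
      exact Part.dom_iff_mem.2 ⟨_, (hTm _ _ _).2 rfl⟩
    obtain ⟨n, hn⟩ := Part.dom_iff_mem.1 this
    refine Part.dom_iff_mem.2 ⟨Nat.pred (v (k + n).unpair.1), ?_⟩
    exact Part.mem_bind hn (Part.mem_map _ ((hvm _ _).2 rfl))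
  have key : (∃ t b, b + 1 ∈ V (a, t)) →
        ∃ s : ℕ → ℕ, (∀ k, s k ∈ S (a, k)) ∧ ∀ b, (∃ k, s k = b) ↔ ∃ t, b + 1 ∈ V (a, t) := by
    rintro ⟨t, b, hb⟩
    rw [hvm] at hb
    have hdom : ∀ k, (S (a, k)).Dom := by
      intro k
      have hk : k ≤ Nat.pair t k := Nat.right_le_pair t k
      apply hSd k (Nat.pair t k - k)
      rw [Nat.add_sub_cancel' hk]
      simp; omega
    choose s hs using fun k => Part.dom_iff_mem.1 (hdom k)
    refine ⟨s, hs, fun c => ⟨?_, ?_⟩⟩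
    · rintro ⟨k, rfl⟩
      obtain ⟨t, ht, -⟩ := hSm k _ (hs k)
      exact ⟨_, (hvm _ _).2 ht.symm⟩
    · rintro ⟨t, ht⟩
      rw [hvm] at ht
      refine ⟨Nat.pair t 0, ?_⟩
      obtain ⟨t', ht', hlt⟩ := hSm _ _ (hs (Nat.pair t 0))
      rcases Nat.eq_zero_or_pos t' with rfl | hpos
      · simp at ht'; omega
      · have := hlt 0 hpos
        simp at this; omega
  refine ⟨⟨fun h => ?_, fun h => ?_⟩, key⟩
  · obtain ⟨b, hb⟩ := Part.dom_iff_mem.1 h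
    obtain ⟨t, ht, -⟩ := hSm _ _ hb
    exact ⟨_, b, (hvm _ _).2 ht.symm⟩
  · obtain ⟨s, hs, -⟩ := key h
    exact Part.dom_iff_mem.2 ⟨_, hs 0⟩

/-- `f : α → ℚ` is computable, as a quotient of a difference of natural numbers. -/
def RatComputable (f : α → ℚ) : Prop :=
  ∃ P N D : α → ℕ, Computable P ∧ Computable N ∧ Computable D ∧
    ∀ a, 0 < D a ∧ f a = ((P a : ℚ) - N a) / D a

theorem computable_natAdd {f g : α → ℕ} (hf : Computable f) (hg : Computable g) :
    Computable fun a => f a + g a := Primrec.nat_add.to_comp.comp hf hg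

theorem computable_natMul {f g : α → ℕ} (hf : Computable f) (hg : Computable g) :
    Computable fun a => f a * g a := Primrec.nat_mul.to_comp.comp hf hg

theorem RatComputable.comp {β : Type*} [Primcodable β] {f : β → ℚ} {g : α → β}
    (hf : RatComputable f) (hg : Computable g) : RatComputable fun a => f (g a) := by
  obtain ⟨P, N, D, hP, hN, hD, h⟩ := hf
  exact ⟨_, _, _, hP.comp hg, hN.comp hg, hD.comp hg, fun a => h (g a)⟩

theorem RatComputable.add {f g : α → ℚ} (hf : RatComputable f) (hg : RatComputable g) :
    RatComputable fun a => f a + g a := by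
  obtain ⟨P, N, D, hP, hN, hD, h⟩ := hf
  obtain ⟨P', N', D', hP', hN', hD', h'⟩ := hg
  refine ⟨_, _, _, computable_natAdd (computable_natMul hP hD') (computable_natMul hP' hD),
    computable_natAdd (computable_natMul hN hD') (computable_natMul hN' hD),
    computable_natMul hD hD', fun a => ⟨Nat.mul_pos (h a).1 (h' a).1, ?_⟩⟩
  have h1 : (D a : ℚ) ≠ 0 := by exact_mod_cast (h a).1.ne'
  have h2 : (D' a : ℚ) ≠ 0 := by exact_mod_cast (h' a).1.ne'
  beta_reduce
  rw [(h a).2, (h' a).2]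
  push_cast
  field_simp
  ring

theorem RatComputable.natCast {f : α → ℕ} (hf : Computable f) :
    RatComputable fun a => (f a : ℚ) :=
  ⟨f, fun _ => 0, fun _ => 1, hf, Computable.const _, Computable.const _, by simp⟩

theorem RatComputable.div_succ (c : ℕ) {f : α → ℕ} (hf : Computable f) :
    RatComputable fun a => (c : ℚ) / (f a + 1) :=
  ⟨fun _ => c, fun _ => 0, fun a => f a + 1, Computable.const _, Computable.const _,
    Computable.succ.comp hf, fun a => ⟨Nat.succ_pos _, by simp⟩⟩

theorem RatComputable.lt {f g : α → ℚ} (hf : RatComputable f) (hg : RatComputable g) :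
    Computable fun a => decide (f a < g a) := by
  obtain ⟨P, N, D, hP, hN, hD, h⟩ := hf
  obtain ⟨P', N', D', hP', hN', hD', h'⟩ := hg
  refine ((Primrec.nat_lt.decide.to_comp).comp
    (computable_natAdd (computable_natMul hP hD') (computable_natMul hN' hD))
    (computable_natAdd (computable_natMul hP' hD) (computable_natMul hN hD'))).of_eq ?_
  intro a
  have h1 : (0 : ℚ) < D a := by exact_mod_cast (h a).1
  have h2 : (0 : ℚ) < D' a := by exact_mod_cast (h' a).1
  have : f a < g a ↔ P a * D' a + N' a * D a < P' a * D a + N a * D' a := by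
    rw [(h a).2, (h' a).2, div_lt_div_iff₀ h1 h2, ← Nat.cast_lt (α := ℚ)]
    push_cast
    constructor <;> intro h <;> linarith
  simp [this]

theorem ratOfNat_encode (q : ℚ) : ratOfNat (Encodable.encode q) = q := by
  simp [ratOfNat]

theorem primrecPred_coprime :
    PrimrecPred fun p : ℕ × ℕ => 0 < p.2 ∧ p.1.Coprime p.2 := by
  have hdvd : PrimrecRel fun (p : ℕ × ℕ) (d : ℕ) => p.1 % d = 0 ∧ p.2 % d = 0 :=
    (Primrec.eq.comp (Primrec.nat_mod.comp (Primrec.fst.comp Primrec.fst) Primrec.snd)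
      (Primrec.const 0)).and
    (Primrec.eq.comp (Primrec.nat_mod.comp (Primrec.snd.comp Primrec.fst) Primrec.snd)
      (Primrec.const 0))
  have hG : Primrec fun p : ℕ × ℕ => Nat.findGreatest (fun d => p.1 % d = 0 ∧ p.2 % d = 0) p.2 :=
    Primrec.nat_findGreatest Primrec.snd hdvd
  refine ((Primrec.nat_lt.comp (Primrec.const 0) Primrec.snd).and
    (Primrec.nat_le.comp hG (Primrec.const 1))).of_eq ?_
  rintro ⟨a, b⟩
  refine and_congr_right fun (hb : 0 < b) => ?_
  have : Nat.findGreatest (fun d => a % d = 0 ∧ b % d = 0) b = a.gcd b := by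
    refine (Nat.findGreatest_eq_iff.2 ⟨Nat.gcd_le_right _ hb, fun _ => ?_, fun n hn _ h => ?_⟩)
    · exact ⟨Nat.mod_eq_zero_of_dvd (Nat.gcd_dvd_left a b),
        Nat.mod_eq_zero_of_dvd (Nat.gcd_dvd_right a b)⟩
    · exact absurd (Nat.le_of_dvd (Nat.gcd_pos_of_pos_right _ hb)
        (Nat.dvd_gcd (Nat.dvd_of_mod_eq_zero h.1) (Nat.dvd_of_mod_eq_zero h.2))) (by omega)
  simp only [this]
  have := Nat.gcd_pos_of_pos_right a hb
  rw [Nat.coprime_iff_gcd_eq_one]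
  omega

theorem intEquivNat_symm_apply (u : ℕ) : Equiv.intEquivNat.symm u =
    ((bif u.bodd then 0 else u.div2 : ℕ) : ℤ) - (bif u.bodd then u.div2 + 1 else 0 : ℕ) := by
  rw [Equiv.symm_apply_eq]
  rcases hb : u.bodd with _ | _
  · conv_lhs => rw [← Nat.bit_bodd_div2 u, hb]
    simp [Equiv.intEquivNat, Equiv.intEquivNatSumNat]
    rfl
  · have : ((0 : ℕ) : ℤ) - ((u.div2 + 1 : ℕ) : ℤ) = Int.negSucc u.div2 := by
      rw [Int.negSucc_eq]; push_cast; ring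
    conv_lhs => rw [← Nat.bit_bodd_div2 u, hb]
    simp only [cond_true, this]
    simp [Equiv.intEquivNat, Equiv.intEquivNatSumNat]

/-- Rationals as pairs of a numerator and a coprime positive denominator. -/
def ratEquivSigma : ℚ ≃ Σ n : ℤ, { d : ℕ // 0 < d ∧ n.natAbs.Coprime d } where
  toFun q := ⟨q.num, q.den, q.pos, q.reduced⟩
  invFun x := ⟨x.1, x.2.1, x.2.2.1.ne', x.2.2.2⟩
  left_inv _ := rfl
  right_inv _ := rfl

theorem instEncodable_eq : Rat.instEncodable = Encodable.ofEquiv _ ratEquivSigma := by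
  obtain ⟨e, he, h⟩ : ∃ e, Rat.instEncodable = Encodable.ofEquiv _ e ∧
      ∀ q, e q = ratEquivSigma q := by
    refine ⟨_, rfl, ?_⟩
    rintro ⟨a, b, c, d⟩
    rfl
  rw [he, Equiv.ext h]

theorem ratOfNat_eq (k : ℕ) : ratOfNat k = if 0 < k.unpair.2 ∧
      (Equiv.intEquivNat.symm k.unpair.1).natAbs.Coprime k.unpair.2 then
        (Equiv.intEquivNat.symm k.unpair.1 : ℚ) / k.unpair.2 else 0 := by
  have h : (Encodable.decode (α := Σ n : ℤ, { d : ℕ // 0 < d ∧ n.natAbs.Coprime d }) k) =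
      if h : 0 < k.unpair.2 ∧ (Equiv.intEquivNat.symm k.unpair.1).natAbs.Coprime k.unpair.2 then
        some ⟨Equiv.intEquivNat.symm k.unpair.1, ⟨k.unpair.2, h⟩⟩ else none := by
    rw [Encodable.decode_sigma_val]
    have : (Encodable.decode k.unpair.1 : Option ℤ) =
      some (Equiv.intEquivNat.symm k.unpair.1) := rfl
    rw [this]
    have h2 : ∀ v, ∀ P : ℕ → Prop, ∀ [DecidablePred P],
      (Encodable.decode v : Option {d : ℕ // P d}) = if h : P v then some ⟨v, h⟩ else none :=
      fun v P _ => rfl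
    simp only [Option.bind_some, h2]
    split_ifs <;> rfl
  have hd : Encodable.decode (α := ℚ) k =
      (Encodable.decode (α := Σ n : ℤ, { d : ℕ // 0 < d ∧ n.natAbs.Coprime d }) k).map
        fun x => (⟨x.1, x.2.1, x.2.2.1.ne', x.2.2.2⟩ : ℚ) := by
    rw [instEncodable_eq, Encodable.decode_ofEquiv]
    rfl
  rw [ratOfNat, hd, h]
  split_ifs with hc
  · simp only [Option.map_some, Option.getD_some]
    exact (Rat.num_div_den _).symm
  · rfl

theorem ratComputable_ratOfNat : RatComputable ratOfNat := by
  have hu : Primrec fun k : ℕ => k.unpair.1 := Primrec.fst.comp Primrec.unpair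
  have hv : Primrec fun k : ℕ => k.unpair.2 := Primrec.snd.comp Primrec.unpair
  let P : ℕ → ℕ := fun u => bif u.bodd then 0 else u.div2
  let N : ℕ → ℕ := fun u => bif u.bodd then u.div2 + 1 else 0
  have hP : Primrec P := Primrec.cond Primrec.nat_bodd (Primrec.const 0) Primrec.nat_div2
  have hN : Primrec N :=
    Primrec.cond Primrec.nat_bodd (Primrec.succ.comp Primrec.nat_div2) (Primrec.const 0)
  have habs : ∀ u, (Equiv.intEquivNat.symm u).natAbs = P u + N u := by
    intro u
    rw [intEquivNat_symm_apply]
    simp only [P, N]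
    cases u.bodd <;> (simp; try omega)
  have hc : PrimrecPred fun k : ℕ => 0 < k.unpair.2 ∧
      (P k.unpair.1 + N k.unpair.1).Coprime k.unpair.2 :=
    primrecPred_coprime.comp
      ((Primrec.nat_add.comp (hP.comp hu) (hN.comp hu)).pair hv)
  refine ⟨_, _, _, (Primrec.ite hc (hP.comp hu) (Primrec.const 0)).to_comp,
    (Primrec.ite hc (hN.comp hu) (Primrec.const 0)).to_comp,
    (Primrec.ite hc hv (Primrec.const 1)).to_comp, fun k => ?_⟩
  rw [ratOfNat_eq, habs]
  split_ifs with h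
  · refine ⟨h.1, ?_⟩
    rw [intEquivNat_symm_apply]
    push_cast
    rfl
  · simp

end Computability

section Names

theorem exists_lRealName {α : Type*} [Primcodable α] {S : α × ℕ →. ℕ} (hS : Partrec S) :
    ∃ c : α → ℕ, Computable c ∧ ∀ a (s : ℕ → ℕ) (L : ℝ), (∀ k, s k ∈ S (a, k)) →
      (∀ k, (ratOfNat (s k) : ℝ) < L) → (∀ z < L, ∃ k, z < (ratOfNat (s k) : ℝ)) →
      LRealName (c a) L := by
  let mx : ℕ → ℕ → ℕ := fun i j => bif decide (ratOfNat i < ratOfNat j) then j else i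
  let M : α × ℕ →. ℕ := fun p => Nat.rec (S (p.1, 0))
    (fun y IH => IH.bind fun i => (S (p.1, y + 1)).map (mx i)) p.2
  have hmx : Computable₂ mx :=
    Computable.cond ((ratComputable_ratOfNat.comp Computable.fst).lt
      (ratComputable_ratOfNat.comp Computable.snd)) Computable.snd Computable.fst
  have hM : Partrec M := by
    refine Partrec.nat_rec (h := fun p q => (S (p.1, q.1 + 1)).map (mx q.2)) Computable.snd
      (hS.comp (Computable.fst.pair (Computable.const 0))) ?_
    refine Partrec.map (hS.comp ((Computable.fst.comp Computable.fst).pair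
      (Computable.succ.comp (Computable.fst.comp Computable.snd)))) ?_
    exact hmx.comp (Computable.snd.comp (Computable.snd.comp Computable.fst)) Computable.snd
  obtain ⟨c, hc, hcM⟩ := exists_phi_eq hM
  refine ⟨c, hc, fun a s L hs hlt hL => ?_⟩
  let m : ℕ → ℕ := fun n => Nat.rec (s 0) (fun y i => mx i (s (y + 1))) n
  have hm : ∀ n, m n ∈ phi (c a) n := by
    intro n
    rw [hcM]
    induction n with
    | zero => exact hs 0
    | succ n ih => exact Part.mem_bind ih (Part.mem_map _ (hs (n + 1)))
  have hmxl : ∀ i j, ratOfNat i ≤ ratOfNat (mx i j) := by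
    intro i j
    by_cases h : ratOfNat i < ratOfNat j
    · simpa [mx, h] using h.le
    · simp [mx, h]
  have hmxr : ∀ i j, ratOfNat j ≤ ratOfNat (mx i j) := by
    intro i j
    by_cases h : ratOfNat i < ratOfNat j <;> simp [mx, h]
    exact not_lt.1 h
  have hmono : Monotone fun n => ratOfNat (m n) :=
    monotone_nat_of_le_succ fun n => hmxl _ _
  have hle : ∀ n, ratOfNat (s n) ≤ ratOfNat (m n) := by
    intro n
    cases n with
    | zero => exact le_rfl
    | succ n => exact hmxr _ _
  have hmlt : ∀ n, (ratOfNat (m n) : ℝ) < L := by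
    intro n
    induction n with
    | zero => exact hlt 0
    | succ n ih =>
      change (ratOfNat (mx (m n) (s (n + 1))) : ℝ) < L
      by_cases h : ratOfNat (m n) < ratOfNat (s (n + 1))
      · simpa [mx, h] using hlt (n + 1)
      · simpa [mx, h] using ih
  refine ⟨m, hm, hmono, hmlt, tendsto_order.2 ⟨fun z hz => ?_, fun z hz => ?_⟩⟩
  · obtain ⟨k, hk⟩ := hL z hz
    refine Filter.eventually_atTop.2 ⟨k, fun n hn => hk.trans_le ?_⟩
    exact_mod_cast (hle k).trans (hmono hn)
  · exact Filter.Eventually.of_forall fun n => (hmlt n).trans hz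

/-- A program constantly equal to `q`. -/
def constCode (q : ℕ) : ℕ := Encodable.encode (Nat.Partrec.Code.const q)

theorem computable_constCode : Computable constCode :=
  Computable.encode.comp Nat.Partrec.Code.primrec_const.to_comp

theorem phi_constCode (q n : ℕ) : phi (constCode q) n = Part.some q := by
  rw [phi, constCode, Denumerable.ofNat_encode, Nat.Partrec.Code.eval_const]

theorem cRealName_constCode (q : ℕ) : CRealName (constCode q) (ratOfNat q) := by
  intro n
  exact ⟨q, by simp [phi_constCode], by simp⟩

theorem CRealName.unique {e : ℕ} {x y : ℝ} (hx : CRealName e x) (hy : CRealName e y) : x = y := by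
  by_contra hne
  have hpos : 0 < |x - y| / 2 := by have := abs_pos.2 (sub_ne_zero.2 hne); linarith
  obtain ⟨n, hn⟩ := exists_pow_lt_of_lt_one hpos (by norm_num : (1 / 2 : ℝ) < 1)
  obtain ⟨a, ha, ha'⟩ := hx n
  obtain ⟨b, hb, hb'⟩ := hy n
  obtain rfl := Part.mem_unique ha hb
  have h2 : (2 : ℝ) ^ (-(n : ℤ)) = (1 / 2) ^ n := by simp
  rw [h2] at ha' hb'
  have := abs_sub_le x (ratOfNat a : ℝ) y
  rw [abs_sub_comm x (ratOfNat a : ℝ)] at this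
  linarith

theorem CRealName.exists_approx {e : ℕ} {x : ℝ} (hx : CRealName e x) :
    ∃ d : ℕ → ℕ, (∀ j, d j ∈ phi e j) ∧ ∀ j : ℕ, |(ratOfNat (d j) : ℝ) - x| < 1 / (j + 1) := by
  choose d hd hd' using hx
  refine ⟨d, hd, fun j => (hd' j).trans_le ?_⟩
  rw [zpow_neg, zpow_natCast, ← one_div]
  refine one_div_le_one_div_of_le (by positivity) ?_
  exact_mod_cast Nat.succ_le_of_lt j.lt_two_pow_self

theorem LRealName.exists_lt {e : ℕ} {ε z : ℝ} (h : LRealName e ε) (hz : z < ε) :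
    ∃ n, ∃ q ∈ phi e n, z < ratOfNat q ∧ (ratOfNat q : ℝ) < ε := by
  obtain ⟨s, hs, -, hlt, ht⟩ := h
  obtain ⟨n, hn⟩ := (ht.eventually (lt_mem_nhds hz)).exists
  exact ⟨n, s n, hs n, hn, hlt n⟩

theorem LRealName.lt_of_mem {e n q : ℕ} {ε : ℝ} (h : LRealName e ε) (hq : q ∈ phi e n) :
    (ratOfNat q : ℝ) < ε := by
  obtain ⟨s, hs, -, hlt, ht⟩ := h
  exact Part.mem_unique (hs n) hq ▸ hlt n

/-- The test comparing `u` with the difference of two approximated real numbers. -/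
def precTest (u d r : ℚ) (j : ℕ) : Prop := u + d + (2 : ℕ) / ((j : ℚ) + 1) < r

instance (u d r : ℚ) (j : ℕ) : Decidable (precTest u d r j) :=
  inferInstanceAs (Decidable (_ < _))

theorem lt_sub_of_precTest {u d r : ℚ} {j : ℕ} {D R : ℝ} (h : precTest u d r j)
    (hd : |(d : ℝ) - D| < 1 / (j + 1)) (hr : |(r : ℝ) - R| < 1 / (j + 1)) : (u : ℝ) < R - D := by
  have h' : (u : ℝ) + d + 2 / (j + 1) < r := by
    have : ((u + d + (2 : ℕ) / ((j : ℚ) + 1) : ℚ) : ℝ) < r := Rat.cast_lt.2 h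
    push_cast at this
    exact this
  have := (abs_lt.1 hd).1
  have := (abs_lt.1 hr).2
  have h3 : (2 : ℝ) / (j + 1) = 1 / (j + 1) + 1 / (j + 1) := by ring
  linarith

theorem eventually_precTest {u : ℚ} {d r : ℕ → ℚ} {D R : ℝ}
    (hd : ∀ j : ℕ, |(d j : ℝ) - D| < 1 / (j + 1)) (hr : ∀ j : ℕ, |(r j : ℝ) - R| < 1 / (j + 1))
    (h : (u : ℝ) < R - D) : ∀ᶠ j in Filter.atTop, precTest u (d j) (r j) j := by
  have hpos : 0 < (R - D - u) / 4 := by linarith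
  have ht := (tendsto_one_div_add_atTop_nhds_zero_nat (𝕜 := ℝ)).eventually (gt_mem_nhds hpos)
  filter_upwards [ht] with j hj
  have : (u : ℝ) + d j + 2 / (j + 1) < r j := by
    have := (abs_lt.1 (hd j)).2
    have := (abs_lt.1 (hr j)).1
    have h3 : (2 : ℝ) / (j + 1) = 1 / (j + 1) + 1 / (j + 1) := by ring
    linarith
  have h2 : ((u + d j + (2 : ℕ) / ((j : ℚ) + 1) : ℚ) : ℝ) < r j := by
    push_cast
    exact this
  exact Rat.cast_lt.1 h2

theorem RatComputable.precTest {α : Type*} [Primcodable α] {u d r : α → ℚ} {j : α → ℕ}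
    (hu : RatComputable u) (hd : RatComputable d) (hr : RatComputable r) (hj : Computable j) :
    Computable fun a => decide (T1.precTest (u a) (d a) (r a) (j a)) :=
  ((hu.add hd).add (RatComputable.div_succ 2 hj)).lt hr

end Names

section Metric

variable {X : Type*} [MetricSpace X] {ν : ℕ →. X}

theorem IsCMS.exists_approx (hX : IsCMS ν) : ∃ A : (ℕ × ℕ) × ℕ →. ℕ, Partrec A ∧
    ∀ n m x y, x ∈ ν n → y ∈ ν m → ∃ d : ℕ → ℕ, (∀ j, d j ∈ A ((n, m), j)) ∧
      ∀ j : ℕ, |(ratOfNat (d j) : ℝ) - dist x y| < 1 / (j + 1) := by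
  obtain ⟨F, hF, h⟩ := hX.dist_comp
  refine ⟨fun p => (F (Nat.pair p.1.1 p.1.2)).bind fun e => phi e p.2, ?_, ?_⟩
  · refine Partrec.bind ((Partrec.nat_iff.2 hF).comp
      (Primrec₂.natPair.to_comp.comp (Computable.fst.comp Computable.fst)
        (Computable.snd.comp Computable.fst))) ?_
    exact partrec_phi.comp Computable.snd (Computable.snd.comp Computable.fst)
  · intro n m x y hx hy
    obtain ⟨e, he, hd⟩ := h n m x y hx hy
    obtain ⟨d, hd, hd'⟩ := hd.exists_approx
    exact ⟨d, fun j => Part.mem_bind he (hd j), hd'⟩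

theorem ballName_constCode {i : ℕ} {x : X} (hx : x ∈ ν i) (q : ℕ) :
    ballName ν (Nat.pair i (constCode q)) (Metric.ball x (ratOfNat q)) :=
  ⟨x, ratOfNat q, by simpa using hx, by simpa using cRealName_constCode q, rfl⟩

theorem exists_ratOfNat_btwn {a b : ℝ} (h : a < b) :
    ∃ q, a < (ratOfNat q : ℝ) ∧ (ratOfNat q : ℝ) < b := by
  obtain ⟨q, h1, h2⟩ := exists_rat_btwn h
  exact ⟨Encodable.encode q, by rwa [ratOfNat_encode], by rwa [ratOfNat_encode]⟩

theorem IsCMS.exists_dist_lt (hX : IsCMS ν) (x : X) {r : ℝ} (hr : 0 < r) :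
    ∃ n c, c ∈ ν n ∧ dist x c < r := by
  obtain ⟨c, ⟨n, hn⟩, hc⟩ := hX.dense.exists_dist_lt x hr
  exact ⟨n, c, hn, hc⟩

theorem IsCMS.generateFrom_ballName (hX : IsCMS ν) :
    TopologicalSpace.generateFrom {B | ∃ b, ballName ν b B} =
      (inferInstance : TopologicalSpace X) := by
  refine (TopologicalSpace.isTopologicalBasis_of_isOpen_of_nhds ?_ ?_).eq_generateFrom.symm
  · rintro _ ⟨b, x, r, -, -, rfl⟩
    exact Metric.isOpen_ball
  · intro a U ha hU
    obtain ⟨ε, hε, hsub⟩ := Metric.isOpen_iff.1 hU a ha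
    obtain ⟨q, hq0, hq⟩ := exists_ratOfNat_btwn (half_pos hε)
    obtain ⟨n, c, hc, hac⟩ := hX.exists_dist_lt a hq0
    refine ⟨_, ⟨_, ballName_constCode hc q⟩, hac, fun z hz => hsub ?_⟩
    rw [Metric.mem_ball] at hz ⊢
    have := dist_triangle z c a
    rw [dist_comm c a] at this
    linarith
end Metric

section SpreenNames

variable {X : Type*} [MetricSpace X] {ν : ℕ →. X}

/-- Packing a semi-decision procedure and a sequence of names, uniformly in a parameter. -/
theorem exists_spreen_code {α : Type*} [Primcodable α] {D : α × ℕ →. ℕ} {S : (α × ℕ) × ℕ →. ℕ}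
    (hD : Partrec D) (hS : Partrec S) : ∃ g : α → ℕ, Computable g ∧ ∀ a i,
      phi (g a).unpair.1 i = D (a, i) ∧
      ∀ k, phi (g a).unpair.2 (Nat.pair i k) = S ((a, i), k) := by
  obtain ⟨c, hc, hcD⟩ := exists_phi_eq hD
  have hS' : Partrec fun p : α × ℕ => S ((p.1, p.2.unpair.1), p.2.unpair.2) :=
    hS.comp ((Computable.fst.pair (Computable.fst.comp (Computable.unpair.comp Computable.snd))).pair
      (Computable.snd.comp (Computable.unpair.comp Computable.snd)))
  obtain ⟨c', hc', hcS⟩ := exists_phi_eq hS'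
  exact ⟨fun a => Nat.pair (c a) (c' a), Primrec₂.natPair.to_comp.comp hc hc',
    fun a i => ⟨by simp [hcD], fun k => by simp [hcS]⟩⟩

theorem eq_of_forall_mem {F : ℕ →. ℕ} {G : ℕ → ℕ} {s t : ℕ → ℕ} (hs : ∀ k, s k ∈ F (G k))
    (ht : ∀ k, t k ∈ F (G k)) : s = t :=
  funext fun k => Part.mem_unique (hs k) (ht k)

/-- The distances from `x` to the spheres bounding the balls listed by the program `p`
at the `ν`-name `i` of `x`. -/
def rad (ν : ℕ →. X) (p i : ℕ) (x : X) : Set ℝ :=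
  {v | ∃ k b c r, b ∈ phi p.unpair.2 (Nat.pair i k) ∧ c ∈ ν b.unpair.1 ∧
    CRealName b.unpair.2 r ∧ v = r - dist c x}

theorem exists_le_of_mem_rad {p p' i i' : ℕ} {s t : ℕ → ℕ} {x : X} {v : ℝ}
    (h : SeqIncl₂ (ballIncl ν) s t) (hs : ∀ k, s k ∈ phi p.unpair.2 (Nat.pair i k))
    (ht : ∀ k, t k ∈ phi p'.unpair.2 (Nat.pair i' k)) (hv : v ∈ rad ν p i x) :
    ∃ v' ∈ rad ν p' i' x, v ≤ v' := by
  obtain ⟨k, b, c, r, hb, hc, hr, rfl⟩ := hv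
  obtain rfl := Part.mem_unique hb (hs k)
  obtain ⟨k', c₁, c', r₁, r', hc₁, hc', hr₁, hr', hle⟩ := h k
  obtain rfl := Part.mem_unique hc hc₁
  obtain rfl := hr.unique hr₁
  refine ⟨_, ⟨k', _, c', r', ht k', hc', hr', rfl⟩, ?_⟩
  have := dist_triangle c' c x
  rw [dist_comm c' c] at this
  linarith

theorem exists_le_of_ballIncl {p i b k : ℕ} {s : ℕ → ℕ} {c x : X} {R : ℝ}
    (hs : ∀ k, s k ∈ phi p.unpair.2 (Nat.pair i k)) (h : ballIncl ν b (s k))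
    (hc : c ∈ ν b.unpair.1) (hR : CRealName b.unpair.2 R) :
    ∃ v ∈ rad ν p i x, R - dist c x ≤ v := by
  obtain ⟨c₁, c', r₁, r', hc₁, hc', hr₁, hr', hle⟩ := h
  obtain rfl := Part.mem_unique hc hc₁
  obtain rfl := hR.unique hr₁
  refine ⟨_, ⟨k, _, c', r', hs k, hc', hr', rfl⟩, ?_⟩
  have := dist_triangle c' c x
  rw [dist_comm c' c] at this
  linarith

section OpenSet

variable {p i : ℕ} {O : Set X} {x : X}

theorem exists_seq_of_spreenName (hp : SpreenName ν (ballName ν) (ballIncl ν) p O)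
    (hx : x ∈ ν i) (hxO : x ∈ O) : ∃ (s : ℕ → ℕ) (c : ℕ → X) (r : ℕ → ℝ),
      (∀ k, s k ∈ phi p.unpair.2 (Nat.pair i k)) ∧ (∀ k, c k ∈ ν (s k).unpair.1) ∧
      (∀ k, CRealName (s k).unpair.2 (r k)) ∧
      (∀ k, dist (c k) x < r k ∧ Metric.ball (c k) (r k) ⊆ O) ∧
      rad ν p i x = Set.range fun k => r k - dist (c k) x := by
  obtain ⟨s, hs, h⟩ := hp.2.1 i x hx hxO
  have h' : ∀ k, ∃ c r, c ∈ ν (s k).unpair.1 ∧ CRealName (s k).unpair.2 r ∧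
      dist c x < r ∧ Metric.ball c r ⊆ O := by
    intro k
    obtain ⟨_, ⟨c, r, hc, hr, rfl⟩, hxB, hB⟩ := h k
    exact ⟨c, r, hc, hr, by rwa [Metric.mem_ball, dist_comm] at hxB, hB⟩
  choose c r hc hr hd using h'
  refine ⟨s, c, r, hs, hc, hr, hd, Set.ext fun v => ⟨?_, ?_⟩⟩
  · rintro ⟨k, b, c', r', hb, hc', hr', rfl⟩
    obtain rfl := Part.mem_unique hb (hs k)
    obtain rfl := Part.mem_unique (hc k) hc'
    obtain rfl := (hr k).unique hr'
    exact ⟨k, rfl⟩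
  · rintro ⟨k, rfl⟩
    exact ⟨k, _, _, _, hs k, hc k, hr k, rfl⟩

theorem rad_nonempty (hp : SpreenName ν (ballName ν) (ballIncl ν) p O)
    (hx : x ∈ ν i) (hxO : x ∈ O) : (rad ν p i x).Nonempty := by
  obtain ⟨s, c, r, -, -, -, -, h⟩ := exists_seq_of_spreenName hp hx hxO
  rw [h]
  exact Set.range_nonempty _

theorem pos_of_mem_rad (hp : SpreenName ν (ballName ν) (ballIncl ν) p O)
    (hx : x ∈ ν i) (hxO : x ∈ O) {v : ℝ} (hv : v ∈ rad ν p i x) : 0 < v := by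
  obtain ⟨s, c, r, -, -, -, hd, h⟩ := exists_seq_of_spreenName hp hx hxO
  rw [h] at hv
  obtain ⟨k, rfl⟩ := hv
  exact sub_pos.2 (hd k).1

theorem mem_of_dist_lt_rad (hp : SpreenName ν (ballName ν) (ballIncl ν) p O)
    (hx : x ∈ ν i) (hxO : x ∈ O) {v : ℝ} (hv : v ∈ rad ν p i x) {y : X} (hy : dist x y < v) :
    y ∈ O := by
  obtain ⟨s, c, r, -, -, -, hd, h⟩ := exists_seq_of_spreenName hp hx hxO
  rw [h] at hv
  obtain ⟨k, rfl⟩ := hv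
  refine (hd k).2 ?_
  rw [Metric.mem_ball']
  have := dist_triangle (c k) x y
  simp only at hy
  linarith

theorem exists_rad_lower_bound (hp : SpreenName ν (ballName ν) (ballIncl ν) p O)
    (hxO : x ∈ O) : ∃ δ > 0, (∀ i y, y ∈ ν i → dist x y < δ → y ∉ O) ∨
      ∀ i y, y ∈ ν i → dist x y < δ → y ∈ O ∧ ∃ v ∈ rad ν p i y, δ < v := by
  obtain ⟨b, B, ⟨c, R, hc, hR, rfl⟩, hxB, h⟩ := hp.2.2.2 x hxO
  rw [Metric.mem_ball'] at hxB
  refine ⟨(R - dist c x) / 2, by linarith, ?_⟩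
  have hball : ∀ y, dist x y < (R - dist c x) / 2 → y ∈ Metric.ball c R := by
    intro y hy
    rw [Metric.mem_ball']
    have := dist_triangle c x y
    linarith
  by_cases hex : ∃ i y, y ∈ ν i ∧ y ∈ Metric.ball c R ∧ y ∈ O
  · have hsub : Metric.ball c R ⊆ O := by
      obtain ⟨i, y, hy, hyB, hyO⟩ := hex
      obtain ⟨s, c', r, hs, hc', hr, hd, -⟩ := exists_seq_of_spreenName hp hy hyO
      obtain ⟨k, c₁, c₂, r₁, r₂, hc₁, hc₂, hr₁, hr₂, hle⟩ := h i y hy hyB s hs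
      obtain rfl := Part.mem_unique hc hc₁
      obtain rfl := hR.unique hr₁
      obtain rfl := Part.mem_unique hc₂ (hc' k)
      obtain rfl := hr₂.unique (hr k)
      exact (Metric.ball_subset_ball' (by linarith)).trans (hd k).2
    refine Or.inr fun i y hy hxy => ⟨hsub (hball y hxy), ?_⟩
    obtain ⟨s, -, -, hs, -⟩ := exists_seq_of_spreenName hp hy (hsub (hball y hxy))
    obtain ⟨k, hk⟩ := h i y hy (hball y hxy) s hs
    obtain ⟨v, hv, hle⟩ := exists_le_of_ballIncl (x := y) hs hk hc hR
    refine ⟨v, hv, ?_⟩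
    have := dist_triangle c x y
    linarith
  · exact Or.inl fun i y hy hxy hyO => hex ⟨i, y, hy, hball y hxy, hyO⟩

/-- Approximating the numbers in `rad ν p i x`, uniformly in the name `p` of an open set and the
name `i` of a point. -/
theorem IsCMS.exists_radTest (hX : IsCMS ν) : ∃ T : ((ℕ × ℕ) × ℕ) × ℕ →. ℕ, Partrec T ∧
    ∀ {p i : ℕ} {O : Set X} {x : X}, SpreenName ν (ballName ν) (ballIncl ν) p O → x ∈ ν i →
      x ∈ O → ∃ δ : ℕ → ℕ → ℕ, (∀ k j, δ k j ∈ T (((p, i), k), j)) ∧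
      ∀ q : ℚ, (∃ k j, precTest q (ratOfNat (δ k j).unpair.1) (ratOfNat (δ k j).unpair.2) j) ↔
        ∃ v ∈ rad ν p i x, (q : ℝ) < v := by
  obtain ⟨A, hA, hA'⟩ := hX.exists_approx
  refine ⟨fun w => (phi w.1.1.1.unpair.2 (Nat.pair w.1.1.2 w.1.2)).bind fun b =>
    (A ((b.unpair.1, w.1.1.2), w.2)).bind fun d =>
      (phi b.unpair.2 w.2).map fun r => Nat.pair d r, ?_, ?_⟩
  · have hu1 : Computable fun n : ℕ => n.unpair.1 := Computable.fst.comp Computable.unpair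
    have hu2 : Computable fun n : ℕ => n.unpair.2 := Computable.snd.comp Computable.unpair
    have f1 := Computable.fst (α := ((ℕ × ℕ) × ℕ)) (β := ℕ)
    refine Partrec.bind (partrec_phi.comp (hu2.comp (Computable.fst.comp (Computable.fst.comp f1)))
      (Primrec₂.natPair.to_comp.comp (Computable.snd.comp (Computable.fst.comp f1))
        (Computable.snd.comp f1))) ?_
    refine Partrec.bind (hA.comp (((hu1.comp Computable.snd).pair
      (Computable.snd.comp (Computable.fst.comp (Computable.fst.comp Computable.fst)))).pair
      (Computable.snd.comp Computable.fst))) ?_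
    refine Partrec.map (partrec_phi.comp (hu2.comp (Computable.snd.comp Computable.fst))
      (Computable.snd.comp (Computable.fst.comp Computable.fst))) ?_
    exact Primrec₂.natPair.to_comp.comp (Computable.snd.comp Computable.fst) Computable.snd
  · intro p i O x hp hx hxO
    obtain ⟨s, c, r, hs, hc, hr, hd, h⟩ := exists_seq_of_spreenName hp hx hxO
    choose D hD hD' using fun k => hA' _ _ _ _ (hc k) hx
    choose E hE hE' using fun k => (hr k).exists_approx
    refine ⟨fun k j => Nat.pair (D k j) (E k j), fun k j => ?_, fun q => ?_⟩
    · exact Part.mem_bind (hs k) (Part.mem_bind (hD k j) (Part.mem_map _ (hE k j)))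
    · simp only [h, Set.exists_range_iff, Nat.unpair_pair]
      refine exists_congr fun k => ⟨?_, fun hq => ?_⟩
      · rintro ⟨j, hj⟩
        exact lt_sub_of_precTest hj (hD' k j) (hE' k j)
      · exact (eventually_precTest (hD' k) (hE' k) hq).exists

end OpenSet

end SpreenNames

section Codes

theorem computable_unpair_fst : Computable fun n : ℕ => n.unpair.1 :=
  Computable.fst.comp Computable.unpair

theorem computable_unpair_snd : Computable fun n : ℕ => n.unpair.2 :=
  Computable.snd.comp Computable.unpair

theorem computable₂_natPair : Computable₂ Nat.pair := Primrec₂.natPair.to_comp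

theorem succ_mem_some_bif {b a : ℕ} {P : Prop} [Decidable P] :
    b + 1 ∈ (Part.some (bif decide P then a + 1 else 0) : Part ℕ) ↔ P ∧ b = a := by
  by_cases h : P <;> simp [h]

theorem ballIncl_refl {Y : Type*} [MetricSpace Y] {μ : ℕ →. Y} {b : ℕ} {B : Set Y}
    (hb : ballName μ b B) : ballIncl μ b b := by
  obtain ⟨c, r, hc, hr, -⟩ := hb
  exact ⟨c, c, r, r, hc, hc, hr, hr, by simp⟩

theorem IsCMS.exists_ballCode {Y : Type*} [MetricSpace Y] {μ : ℕ →. Y} (hY : IsCMS μ) :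
    ∃ g : ℕ × ℕ → ℕ, Computable g ∧
    (∀ m e y ε, y ∈ μ m → LRealName e ε →
      SpreenName μ (ballName μ) (ballIncl μ) (g (m, e)) (Metric.ball y ε)) ∧
    ∀ m m' e e' y y' ε ε', y ∈ μ m → y' ∈ μ m' → LRealName e ε → LRealName e' ε' →
      dist y y' + ε ≤ ε' → SpreenTauIncl μ (ballIncl μ) (g (m, e)) (g (m', e')) := by
  obtain ⟨A, hA, hA'⟩ := hY.exists_approx
  let V : ((ℕ × ℕ) × ℕ) × ℕ →. ℕ := fun p =>
    (A ((p.1.1.1, p.1.2), p.2.unpair.2)).bind fun d => (phi p.1.1.2 p.2.unpair.1).map fun q =>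
      bif decide (precTest (0 : ℕ) (ratOfNat d) (ratOfNat q) p.2.unpair.2) then
        Nat.pair p.1.1.1 (constCode q) + 1 else 0
  have hV : Partrec V := by
    have f1 := Computable.fst (α := (ℕ × ℕ) × ℕ) (β := ℕ)
    refine Partrec.bind (hA.comp (((Computable.fst.comp (Computable.fst.comp f1)).pair
      (Computable.snd.comp f1)).pair (computable_unpair_snd.comp Computable.snd))) ?_
    refine Partrec.map (partrec_phi.comp
      (Computable.snd.comp (Computable.fst.comp (f1.comp Computable.fst)))
      (computable_unpair_fst.comp (Computable.snd.comp Computable.fst))) ?_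
    refine Computable.cond (RatComputable.precTest (RatComputable.natCast (Computable.const 0))
      (ratComputable_ratOfNat.comp (Computable.snd.comp Computable.fst))
      (ratComputable_ratOfNat.comp Computable.snd)
      (computable_unpair_snd.comp (Computable.snd.comp (Computable.fst.comp Computable.fst))))
      (Computable.succ.comp (computable₂_natPair.comp
        (Computable.fst.comp (Computable.fst.comp (f1.comp (Computable.fst.comp Computable.fst))))
        (computable_constCode.comp Computable.snd))) (Computable.const 0)
  obtain ⟨S, hS, hSV⟩ := exists_enum hV
  obtain ⟨g, hg, hgS⟩ := exists_spreen_code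
    (hS.comp (Computable.id.pair (Computable.const 0))) hS
  have hspec : ∀ {m e i y z ε}, y ∈ μ m → z ∈ μ i → LRealName e ε →
      (∀ t, (V (((m, e), i), t)).Dom) ∧ ∀ b, (∃ t, b + 1 ∈ V (((m, e), i), t)) ↔
        ∃ n, ∃ q ∈ phi e n, dist y z < ratOfNat q ∧ b = Nat.pair m (constCode q) := by
    intro m e i y z ε hy hz he
    obtain ⟨d, hd, hd'⟩ := hA' _ _ _ _ hy hz
    obtain ⟨q, hq, -⟩ := he
    have hVt : ∀ t, V (((m, e), i), t) = Part.some (bif decide (precTest (0 : ℕ)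
        (ratOfNat (d t.unpair.2)) (ratOfNat (q t.unpair.1)) t.unpair.2) then
        Nat.pair m (constCode (q t.unpair.1)) + 1 else 0) := by
      intro t
      simp only [V, Part.eq_some_iff.2 (hd _), Part.eq_some_iff.2 (hq _), Part.bind_some,
        Part.map_some]
    refine ⟨fun t => by rw [hVt]; trivial, fun b => ?_⟩
    simp only [hVt, succ_mem_some_bif]
    constructor
    · rintro ⟨t, ht, rfl⟩
      have h0 : ∀ j : ℕ, |((ratOfNat (q t.unpair.1) : ℚ) : ℝ) - ratOfNat (q t.unpair.1)| <
        1 / ((j : ℝ) + 1) := fun j => by simp only [sub_self, abs_zero]; positivity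
      have := lt_sub_of_precTest ht (hd' _) (h0 _)
      refine ⟨_, _, hq _, ?_, rfl⟩
      push_cast at this
      linarith
    · rintro ⟨n, q', hq', hlt, rfl⟩
      obtain rfl := Part.mem_unique hq' (hq n)
      have h0 : ∀ j : ℕ, |((ratOfNat (q n) : ℚ) : ℝ) - ratOfNat (q n)| <
        1 / ((j : ℝ) + 1) := fun j => by simp only [sub_self, abs_zero]; positivity
      obtain ⟨j, hj⟩ := (eventually_precTest (u := (0 : ℕ)) hd' h0
        (by push_cast; linarith)).exists
      exact ⟨Nat.pair n j, by simpa using hj, by simp⟩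
  have hdom : ∀ {m e i y z ε}, y ∈ μ m → z ∈ μ i → LRealName e ε →
      ((phi (g (m, e)).unpair.1 i).Dom ↔ dist y z < ε) := by
    intro m e i y z ε hy hz he
    obtain ⟨ht, hb⟩ := hspec hy hz he
    rw [(hgS (m, e) i).1]
    refine (hSV _ ht).1.trans ?_
    rw [exists_comm]
    simp only [hb]
    constructor
    · rintro ⟨-, n, q, hq, hlt, -⟩
      exact hlt.trans (he.lt_of_mem hq)
    · intro hlt
      obtain ⟨n, q, hq, hlt, -⟩ := he.exists_lt hlt
      exact ⟨_, n, q, hq, hlt, rfl⟩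
  have hseq : ∀ {m e i y z ε}, y ∈ μ m → z ∈ μ i → LRealName e ε → dist y z < ε →
      ∃ s : ℕ → ℕ, (∀ k, s k ∈ phi (g (m, e)).unpair.2 (Nat.pair i k)) ∧
        ∀ b, (∃ k, s k = b) ↔
          ∃ n, ∃ q ∈ phi e n, dist y z < ratOfNat q ∧ b = Nat.pair m (constCode q) := by
    intro m e i y z ε hy hz he hlt
    obtain ⟨ht, hb⟩ := hspec hy hz he
    obtain ⟨n, q, hq, hlt, -⟩ := he.exists_lt hlt
    obtain ⟨t, h⟩ := (hb _).2 ⟨n, q, hq, hlt, rfl⟩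
    obtain ⟨s, hs, hs'⟩ := (hSV _ ht).2 ⟨t, _, h⟩
    exact ⟨s, fun k => by rw [(hgS _ _).2]; exact hs k, fun b => (hs' b).trans (hb b)⟩
  have hmono : ∀ {m m' e e' i i' y y' z ε ε'} {s t : ℕ → ℕ}, y ∈ μ m → y' ∈ μ m' →
      z ∈ μ i → z ∈ μ i' → LRealName e ε → LRealName e' ε' → dist y y' + ε ≤ ε' →
      dist y z < ε → (∀ k, s k ∈ phi (g (m, e)).unpair.2 (Nat.pair i k)) →
      (∀ k, t k ∈ phi (g (m', e')).unpair.2 (Nat.pair i' k)) →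
      SeqIncl₂ (ballIncl μ) s t := by
    intro m m' e e' i i' y y' z ε ε' s t hy hy' hz hz' he he' hle hlt hs ht k
    have htri := dist_triangle y' y z
    rw [dist_comm y' y] at htri
    obtain ⟨s', hs', hsb⟩ := hseq hy hz he hlt
    obtain ⟨t', ht', htb⟩ := hseq hy' hz' he' (by linarith)
    obtain rfl := eq_of_forall_mem hs hs'
    obtain rfl := eq_of_forall_mem ht ht'
    obtain ⟨n, q, hq, hzq, hk⟩ := (hsb _).1 ⟨k, rfl⟩
    have := he.lt_of_mem hq
    obtain ⟨n', q', hq', hlt', -⟩ := he'.exists_lt (z := dist y y' + ratOfNat q) (by linarith)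
    obtain ⟨k', hk'⟩ := (htb _).2 ⟨n', q', hq', by linarith, rfl⟩
    refine ⟨k', ?_⟩
    rw [hk, hk']
    exact ⟨y, y', _, _, by simpa using hy, by simpa using hy', by
      simpa using cRealName_constCode q, by simpa using cRealName_constCode q', hlt'.le⟩
  refine ⟨g, hg, fun m e y ε hy he => ⟨fun i z hz => ?_, fun i z hz hzO => ?_,
    fun i i' z s t hz hz' hzO hs ht => ?_, fun z hzO => ?_⟩,
    fun m m' e e' y y' ε ε' hy hy' he he' hle i hi hdi => ?_⟩
  · rw [hdom hy hz he, Metric.mem_ball']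
  · rw [Metric.mem_ball'] at hzO
    obtain ⟨s, hs, hb⟩ := hseq hy hz he hzO
    refine ⟨s, hs, fun k => ?_⟩
    obtain ⟨n, q, hq, hlt, hk⟩ := (hb _).1 ⟨k, rfl⟩
    rw [hk]
    exact ⟨_, ballName_constCode hy q, Metric.mem_ball'.2 hlt,
      Metric.ball_subset_ball (he.lt_of_mem hq).le⟩
  · rw [Metric.mem_ball'] at hzO
    exact ⟨hmono hy hy hz hz' he he (by simp) hzO hs ht,
      hmono hy hy hz' hz he he (by simp) hzO ht hs⟩
  · rw [Metric.mem_ball'] at hzO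
    obtain ⟨n, q, hq, hlt, -⟩ := he.exists_lt hzO
    refine ⟨_, _, ballName_constCode hy q, Metric.mem_ball'.2 hlt, fun i w hw hwB s hs => ?_⟩
    rw [Metric.mem_ball'] at hwB
    obtain ⟨s', hs', hb⟩ := hseq hy hw he (hwB.trans (he.lt_of_mem hq))
    obtain rfl := eq_of_forall_mem hs hs'
    obtain ⟨k, hk⟩ := (hb _).2 ⟨n, q, hq, hwB, rfl⟩
    refine ⟨k, ?_⟩
    rw [hk]
    exact ballIncl_refl (ballName_constCode hy q)
  · obtain ⟨z, hz⟩ := Part.dom_iff_mem.1 hi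
    rw [hdom hy hz he] at hdi
    have htri := dist_triangle y' y z
    rw [dist_comm y' y] at htri
    exact ⟨(hdom hy' hz he').2 (by linarith), fun s t hs ht =>
      hmono hy hy' hz hz he he' hle hdi hs ht⟩

theorem IsCMS.exists_radCode {X : Type*} [MetricSpace X] {ν : ℕ →. X} (hX : IsCMS ν) :
    ∃ c : ℕ × ℕ → ℕ, Computable c ∧ ∀ {p i : ℕ} {O : Set X} {x : X},
      SpreenName ν (ballName ν) (ballIncl ν) p O → x ∈ ν i → x ∈ O →
      LRealName (c (p, i)) (sSup (min 1 '' rad ν p i x)) := by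
  obtain ⟨T, hT, hT'⟩ := hX.exists_radTest
  let V : (ℕ × ℕ) × ℕ →. ℕ := fun p =>
    (T ((p.1, p.2.unpair.2.unpair.1), p.2.unpair.2.unpair.2)).map fun w =>
      bif decide (ratOfNat p.2.unpair.1 < (1 : ℕ)) &&
        decide (precTest (ratOfNat p.2.unpair.1) (ratOfNat w.unpair.1) (ratOfNat w.unpair.2)
          p.2.unpair.2.unpair.2) then p.2.unpair.1 + 1 else 0
  have hV : Partrec V := by
    have s1 := computable_unpair_fst.comp (Computable.snd (α := ℕ × ℕ) (β := ℕ))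
    have s2 := computable_unpair_snd.comp (Computable.snd (α := ℕ × ℕ) (β := ℕ))
    refine Partrec.map (hT.comp ((Computable.fst.pair (computable_unpair_fst.comp s2)).pair
      (computable_unpair_snd.comp s2))) ?_
    refine Computable.cond (Primrec.and.to_comp.comp
      ((ratComputable_ratOfNat.comp (s1.comp Computable.fst)).lt
        (RatComputable.natCast (Computable.const 1)))
      (RatComputable.precTest (ratComputable_ratOfNat.comp (s1.comp Computable.fst))
        (ratComputable_ratOfNat.comp (computable_unpair_fst.comp Computable.snd))
        (ratComputable_ratOfNat.comp (computable_unpair_snd.comp Computable.snd))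
        (computable_unpair_snd.comp (s2.comp Computable.fst))))
      (Computable.succ.comp (s1.comp Computable.fst)) (Computable.const 0)
  obtain ⟨S, hS, hSV⟩ := exists_enum hV
  obtain ⟨c, hc, hcS⟩ := exists_lRealName hS
  refine ⟨c, hc, fun {p i O x} hp hx hxO => ?_⟩
  obtain ⟨δ, hδ, hδ'⟩ := hT' hp hx hxO
  have hVt : ∀ t, V ((p, i), t) = Part.some (bif decide (ratOfNat t.unpair.1 < (1 : ℕ) ∧
      precTest (ratOfNat t.unpair.1)
        (ratOfNat (δ t.unpair.2.unpair.1 t.unpair.2.unpair.2).unpair.1)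
        (ratOfNat (δ t.unpair.2.unpair.1 t.unpair.2.unpair.2).unpair.2)
        t.unpair.2.unpair.2) then t.unpair.1 + 1 else 0) := by
    intro t
    simp only [V, Part.eq_some_iff.2 (hδ _ _), Part.map_some, Bool.decide_and]
  have hb : ∀ q, (∃ t, q + 1 ∈ V ((p, i), t)) ↔
      (ratOfNat q : ℝ) < 1 ∧ ∃ v ∈ rad ν p i x, (ratOfNat q : ℝ) < v := by
    intro q
    rw [← hδ']
    simp only [hVt, succ_mem_some_bif]
    constructor
    · rintro ⟨t, ⟨h1, h2⟩, rfl⟩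
      exact ⟨by exact_mod_cast h1, _, _, h2⟩
    · rintro ⟨h1, k, j, h2⟩
      refine ⟨Nat.pair q (Nat.pair k j), ⟨?_, ?_⟩, by simp⟩
      · rw [Nat.unpair_pair]
        exact_mod_cast h1
      · simpa using h2
  have hbdd : BddAbove (min 1 '' rad ν p i x) :=
    ⟨1, by rintro _ ⟨v, -, rfl⟩; exact min_le_left _ _⟩
  have hex : ∀ z < sSup (min 1 '' rad ν p i x), ∃ q, z < ratOfNat q ∧
      ∃ t, q + 1 ∈ V ((p, i), t) := by
    intro z hz
    obtain ⟨_, ⟨v, hv, rfl⟩, hlt⟩ := exists_lt_of_lt_csSup ((rad_nonempty hp hx hxO).image _) hz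
    obtain ⟨q, hzq, hq⟩ := exists_ratOfNat_btwn hlt
    exact ⟨q, hzq, (hb q).2 ⟨hq.trans_le (min_le_left _ _), v, hv, hq.trans_le (min_le_right _ _)⟩⟩
  obtain ⟨q, -, t, ht⟩ := hex _ (sub_one_lt _)
  obtain ⟨s, hs, hs'⟩ := (hSV (p, i) fun t => by rw [hVt]; trivial).2 ⟨t, q, ht⟩
  refine hcS _ s _ hs (fun k => ?_) fun z hz => ?_
  · obtain ⟨h1, v, hv, h2⟩ := (hb _).1 ((hs' _).1 ⟨k, rfl⟩)
    exact (lt_min h1 h2).trans_le (le_csSup hbdd ⟨v, hv, rfl⟩)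
  · obtain ⟨q, hzq, hq⟩ := hex z hz
    obtain ⟨k, rfl⟩ := (hs' q).2 hq
    exact ⟨k, hzq⟩

/-- Left names of the numbers `1 / (m + 1)`. -/
theorem exists_lRealName_one_div :
    ∃ l : ℕ → ℕ, Computable l ∧ ∀ m : ℕ, LRealName (l m) (1 / ((m : ℝ) + 1)) := by
  let V : ℕ × ℕ →. ℕ := fun p => Part.some
    (bif decide (ratOfNat p.2 < (1 : ℕ) / ((p.1 : ℚ) + 1)) then p.2 + 1 else 0)
  have hV : Partrec V := Computable.partrec (Computable.cond
    ((ratComputable_ratOfNat.comp Computable.snd).lt (RatComputable.div_succ 1 Computable.fst))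
      (Computable.succ.comp Computable.snd) (Computable.const 0))
  obtain ⟨S, hS, hSV⟩ := exists_enum hV
  obtain ⟨c, hc, hcS⟩ := exists_lRealName hS
  refine ⟨c, hc, fun m => ?_⟩
  have hb : ∀ q, (∃ t, q + 1 ∈ V (m, t)) ↔ (ratOfNat q : ℝ) < 1 / ((m : ℝ) + 1) := by
    intro q
    have h : (ratOfNat q : ℝ) < 1 / ((m : ℝ) + 1) ↔ ratOfNat q < (1 : ℕ) / ((m : ℚ) + 1) := by
      rw [← Rat.cast_lt (K := ℝ)]
      push_cast
      rfl
    simp only [V, succ_mem_some_bif, h]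
    exact ⟨fun ⟨t, ht, h⟩ => h ▸ ht, fun ht => ⟨q, ht, rfl⟩⟩
  obtain ⟨q, -, hq⟩ := exists_ratOfNat_btwn (sub_one_lt (1 / ((m : ℝ) + 1)))
  obtain ⟨t, ht⟩ := (hb q).2 hq
  obtain ⟨s, hs, hs'⟩ := (hSV m fun t => trivial).2 ⟨t, q, ht⟩
  refine hcS _ s _ hs (fun k => (hb _).1 ((hs' _).1 ⟨k, rfl⟩)) fun z hz => ?_
  obtain ⟨q, hzq, hq⟩ := exists_ratOfNat_btwn hz
  obtain ⟨k, rfl⟩ := (hs' q).2 ((hb q).2 hq)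
  exact ⟨k, hzq⟩

end Codes

theorem sSup_min_image_le {A B : Set ℝ} (hA : A.Nonempty) (h : ∀ v ∈ A, ∃ v' ∈ B, v ≤ v') :
    sSup (min 1 '' A) ≤ sSup (min 1 '' B) := by
  refine csSup_le (hA.image _) ?_
  rintro _ ⟨v, hv, rfl⟩
  obtain ⟨v', hv', hle⟩ := h v hv
  have hbdd : BddAbove (min 1 '' B) := ⟨1, by rintro _ ⟨v, -, rfl⟩; exact min_le_left _ _⟩
  exact (min_le_min_left 1 hle).trans (le_csSup hbdd ⟨v', hv', rfl⟩)

theorem min_le_sSup_min_image {A : Set ℝ} {v : ℝ} (hv : v ∈ A) :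
    min 1 v ≤ sSup (min 1 '' A) :=
  le_csSup ⟨1, by rintro _ ⟨v, -, rfl⟩; exact min_le_left _ _⟩ ⟨v, hv, rfl⟩

section Equivalence

variable {X Y : Type*} [MetricSpace X] [MetricSpace Y] {ν : ℕ →. X} {μ : ℕ →. Y} {f : X → Y}

theorem formalEffMetricCont_of_effContinuousF (hX : IsCMS ν) (hY : IsCMS μ) (hf : Computes ν μ f)
    (h : EffContinuousF (TopologicalSpace.generateFrom {B | ∃ b, ballName ν b B})
        (TopologicalSpace.generateFrom {B | ∃ b, ballName μ b B})
        (SpreenName ν (ballName ν) (ballIncl ν))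
        (SpreenName μ (ballName μ) (ballIncl μ))
        (SpreenTauIncl ν (ballIncl ν)) (SpreenTauIncl μ (ballIncl μ)) f) :
    FormalEffMetricCont ν f := by
  obtain ⟨hcont, h, hh, hname, hmono⟩ := h
  rw [hX.generateFrom_ballName, hY.generateFrom_ballName] at hcont
  obtain ⟨F, hF, hFf⟩ := hf
  obtain ⟨g, hg, hgname, hgmono⟩ := hY.exists_ballCode
  obtain ⟨c, hc, hcname⟩ := hX.exists_radCode
  have hu : ∀ {x i e ε}, f x ∈ μ i → LRealName e ε → ∃ u ∈ h (g (i, e)),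
      SpreenName ν (ballName ν) (ballIncl ν) u (f ⁻¹' Metric.ball (f x) ε) :=
    fun hx he => hname _ _ (hgname _ _ _ _ hx he)
  have hmem : ∀ {x : X} {ε : ℝ}, 0 < ε → x ∈ f ⁻¹' Metric.ball (f x) ε :=
    fun hε => Metric.mem_ball_self hε
  have hincl : ∀ {x y : X} {n i i' e e' u u' : ℕ} {ε ε' : ℝ}, f x ∈ μ i → y ∈ ν n → f y ∈ μ i' →
      LRealName e ε → LRealName e' ε' → u ∈ h (g (i, e)) → u' ∈ h (g (i', e')) → 0 < ε' →
      dist (f x) (f y) < ε → dist (f x) (f y) + ε ≤ ε' →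
      ∀ v ∈ rad ν u n y, ∃ v' ∈ rad ν u' n y, v ≤ v' := by
    intro x y n i i' e e' u u' ε ε' hx hn hy he he' hu₁ hu₂ hε' hlt hle v hv
    obtain ⟨u₁, hu₁', hu₁n⟩ := hu hx he
    obtain ⟨u₂, hu₂', hu₂n⟩ := hu hy he'
    obtain rfl := Part.mem_unique hu₁ hu₁'
    obtain rfl := Part.mem_unique hu₂ hu₂'
    have hyO : y ∈ f ⁻¹' Metric.ball (f x) ε := Metric.mem_ball'.2 hlt
    obtain ⟨s, -, -, hs, -⟩ := exists_seq_of_spreenName hu₁n hn hyO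
    obtain ⟨t, -, -, ht, -⟩ := exists_seq_of_spreenName hu₂n hn (hmem hε')
    have := hmono _ _ _ _ (hgname _ _ _ _ hx he) (hgname _ _ _ _ hy he')
      (hgmono _ _ _ _ _ _ _ _ hx hy he he' hle) _ hu₁ _ hu₂ n (Part.dom_iff_mem.2 ⟨y, hn⟩)
      ((hu₁n.1 n y hn).2 hyO)
    exact exists_le_of_mem_rad (this.2 s t hs ht) hs ht hv
  have hindep : ∀ {x : X} {n n' i i' e e' u u' : ℕ} {ε : ℝ}, x ∈ ν n → x ∈ ν n' → f x ∈ μ i →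
      f x ∈ μ i' → LRealName e ε → LRealName e' ε → u ∈ h (g (i, e)) → u' ∈ h (g (i', e')) →
      0 < ε → ∀ v ∈ rad ν u n x, ∃ v' ∈ rad ν u' n' x, v ≤ v' := by
    intro x n n' i i' e e' u u' ε hn hn' hi hi' he he' hu₁ hu₂ hε v hv
    obtain ⟨v', hv', hle⟩ := hincl hi hn hi' he he' hu₁ hu₂ hε (by simpa) (by simp) v hv
    obtain ⟨u₂, hu₂', hu₂n⟩ := hu hi' he'
    obtain rfl := Part.mem_unique hu₂ hu₂'
    obtain ⟨s, -, -, hs, -⟩ := exists_seq_of_spreenName hu₂n hn (hmem hε)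
    obtain ⟨t, -, -, ht, -⟩ := exists_seq_of_spreenName hu₂n hn' (hmem hε)
    obtain ⟨w, hw, hle'⟩ := exists_le_of_mem_rad
      (hu₂n.2.2.1 n n' x s t hn hn' (hmem hε) hs ht).1 hs ht hv'
    exact ⟨w, hw, hle.trans hle'⟩
  let φ : X → ℝ → ℝ := fun x ε => sSup (min 1 '' {v | ∃ n i e u, x ∈ ν n ∧ f x ∈ μ i ∧
    LRealName e ε ∧ u ∈ h (g (i, e)) ∧ v ∈ rad ν u n x})
  have hφ : ∀ {x n i e u ε}, x ∈ ν n → f x ∈ μ i → LRealName e ε → u ∈ h (g (i, e)) → 0 < ε →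
      φ x ε = sSup (min 1 '' rad ν u n x) := by
    intro x n i e u ε hn hi he hui hε
    obtain ⟨u₂, hu₂, hun⟩ := hu hi he
    obtain rfl := Part.mem_unique hui hu₂
    obtain ⟨v, hv⟩ := rad_nonempty hun hn (hmem hε)
    refine le_antisymm (sSup_min_image_le ⟨v, n, i, e, u, hn, hi, he, hui, hv⟩ ?_)
      (sSup_min_image_le ⟨v, hv⟩ fun w hw => ⟨w, ⟨n, i, e, u, hn, hi, he, hui, hw⟩, le_rfl⟩)
    rintro w ⟨n', i', e', u', hn', hi', he', hu', hw⟩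
    exact hindep hn' hn hi' hi he' he hu' hui hε w hw
  have hex : ∀ {x ε}, (∃ n, x ∈ ν n) → (∃ e, LRealName e ε) → (0 : ℝ) < ε →
      ∃ n u, x ∈ ν n ∧ SpreenName ν (ballName ν) (ballIncl ν) u (f ⁻¹' Metric.ball (f x) ε) ∧
        φ x ε = sSup (min 1 '' rad ν u n x) := by
    rintro x ε ⟨n, hn⟩ ⟨e, he⟩ hε
    obtain ⟨i, -, hi⟩ := hFf n x hn
    obtain ⟨u, hui, hun⟩ := hu hi he
    exact ⟨n, u, hn, hun, hφ hn hi he hui hε⟩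
  refine ⟨φ, ⟨fun w => (F w.unpair.1).bind fun i => (h (g (i, w.unpair.2))).bind fun u =>
    Part.some (c (u, w.unpair.1)), ?_, ?_⟩, ?_, ?_, ?_⟩
  · refine Partrec.nat_iff.1 (Partrec.bind ((Partrec.nat_iff.2 hF).comp computable_unpair_fst) ?_)
    refine Partrec.bind ((Partrec.nat_iff.2 hh).comp (hg.comp
      (Computable.snd.pair (computable_unpair_snd.comp Computable.fst)))) ?_
    exact (hc.comp (Computable.snd.pair
      (computable_unpair_fst.comp (Computable.fst.comp Computable.fst)))).partrec
  · intro n x e ε hn he hε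
    obtain ⟨i, hi, hfi⟩ := hFf n x hn
    obtain ⟨u, hui, hun⟩ := hu hfi he
    refine ⟨c (u, n), ?_, ?_⟩
    · simp only [Nat.unpair_pair]
      exact Part.mem_bind hi (Part.mem_bind hui (Part.mem_some _))
    · rw [hφ hn hfi he hui hε]
      exact hcname hun hn (hmem hε)
  · intro x ε hx he hε
    obtain ⟨n, u, hn, hun, hφx⟩ := hex hx he hε
    obtain ⟨v, hv⟩ := rad_nonempty hun hn (hmem hε)
    rw [hφx]
    exact (lt_min one_pos (pos_of_mem_rad hun hn (hmem hε) hv)).trans_le (min_le_sSup_min_image hv)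
  · intro x y ε hx he hε hxy
    obtain ⟨n, u, hn, hun, hφx⟩ := hex hx he hε
    rw [hφx] at hxy
    obtain ⟨_, ⟨v, hv, rfl⟩, hlt⟩ :=
      exists_lt_of_lt_csSup ((rad_nonempty hun hn (hmem hε)).image _) hxy
    exact Metric.mem_ball'.1
      (mem_of_dist_lt_rad hun hn (hmem hε) hv (hlt.trans_le (min_le_right _ _)))
  · rintro x ε ⟨e, he⟩ hε
    obtain ⟨l, -, hl⟩ := exists_lRealName_one_div
    obtain ⟨m, hm⟩ := exists_nat_one_div_lt (half_pos hε)
    have hε₀ : (0 : ℝ) < 1 / ((m : ℝ) + 1) := by positivity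
    set ε₀ : ℝ := 1 / ((m : ℝ) + 1)
    obtain ⟨ρ, hρ, hρf⟩ := Metric.continuous_iff.1 hcont x (ε₀ / 2) (by linarith)
    obtain ⟨n₀, y₀, hn₀, hy₀⟩ := hX.exists_dist_lt x hρ
    obtain ⟨i₀, -, hi₀⟩ := hFf n₀ y₀ hn₀
    obtain ⟨u₀, hu₀, hu₀n⟩ := hu hi₀ (hl m)
    rw [dist_comm] at hy₀
    have hd₀ := hρf y₀ hy₀
    have hnear : ∀ y, dist x y < ρ → dist (f y₀) (f y) < ε₀ := by
      intro y hy
      rw [dist_comm] at hy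
      have h1 := hρf y hy
      have h2 := dist_triangle_right (f y₀) (f y) (f x)
      linarith
    obtain ⟨δ, hδ, hδ'⟩ := exists_rad_lower_bound (x := x) hu₀n
      (Metric.mem_ball'.2 (hd₀.trans (half_lt_self hε₀)))
    refine ⟨min 1 (min δ ρ), by positivity, fun y hxy hy => ?_⟩
    obtain ⟨n, hn⟩ := hy
    have hxρ : dist x y < ρ := hxy.trans_le ((min_le_right _ _).trans (min_le_right _ _))
    have hxδ : dist x y < δ := hxy.trans_le ((min_le_right _ _).trans (min_le_left _ _))
    obtain ⟨i, -, hi⟩ := hFf n y hn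
    obtain ⟨u, hui, hun⟩ := hu hi he
    rw [hφ hn hi he hui hε]
    rcases hδ' with hδ' | hδ'
    · exact absurd (Metric.mem_ball'.2 (hnear y hxρ)) (hδ' n y hn hxδ)
    · obtain ⟨-, v, hv, hδv⟩ := hδ' n y hn hxδ
      obtain ⟨v', hv', hle⟩ := hincl hi₀ hn hi (hl m) he hu₀ hui hε (hnear y hxρ)
        (by have := hnear y hxρ; linarith) v hv
      refine le_trans ?_ (min_le_sSup_min_image hv')
      exact min_le_min_left 1 ((min_le_left _ _).trans (hδv.le.trans hle))
theorem FormalEffMetricCont.continuous (hX : IsCMS ν) (h : FormalEffMetricCont ν f) :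
    Continuous f := by
  obtain ⟨φ, -, -, hest, hnv⟩ := h
  obtain ⟨l, -, hl⟩ := exists_lRealName_one_div
  refine Metric.continuous_iff.2 fun x ε hε => ?_
  obtain ⟨m, hm⟩ := exists_nat_one_div_lt (half_pos hε)
  have hε₀ : (0 : ℝ) < 1 / ((m : ℝ) + 1) := by positivity
  obtain ⟨r, hr, hφ⟩ := hnv x _ ⟨_, hl m⟩ hε₀
  refine ⟨r / 2, half_pos hr, fun y hy => ?_⟩
  obtain ⟨n, c, hc, hxc⟩ := hX.exists_dist_lt x (half_pos hr)
  have hrφ := hφ c (by linarith) ⟨n, hc⟩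
  have h1 := hest c x _ ⟨n, hc⟩ ⟨_, hl m⟩ hε₀ (by rw [dist_comm]; linarith)
  have h2 := hest c y _ ⟨n, hc⟩ ⟨_, hl m⟩ hε₀ (by
    have := dist_triangle c x y
    rw [dist_comm c x, dist_comm x y] at this
    linarith)
  have := dist_triangle_left (f y) (f x) (f c)
  linarith

theorem FormalEffMetricCont.effContinuousF (hX : IsCMS ν) (hY : IsCMS μ) (hf : Computes ν μ f)
    (h : FormalEffMetricCont ν f) :
    EffContinuousF (TopologicalSpace.generateFrom {B | ∃ b, ballName ν b B})
        (TopologicalSpace.generateFrom {B | ∃ b, ballName μ b B})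
        (SpreenName ν (ballName ν) (ballIncl ν))
        (SpreenName μ (ballName μ) (ballIncl μ))
        (SpreenTauIncl ν (ballIncl ν)) (SpreenTauIncl μ (ballIncl μ)) f := by
  have hcont := h.continuous hX
  obtain ⟨φ, ⟨H, hH, hHφ⟩, hpos, hest, hnv⟩ := h
  obtain ⟨F, hF, hFf⟩ := hf
  obtain ⟨l, hlc, hl⟩ := exists_lRealName_one_div
  obtain ⟨T, hT, hT'⟩ := hY.exists_radTest
  have hε : ∀ m : ℕ, (0 : ℝ) < 1 / ((m : ℝ) + 1) := fun m => by positivity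
  let V : (ℕ × ℕ) × ℕ →. ℕ := fun p => (F p.1.2).bind fun i' =>
    (T (((p.1.1, i'), p.2.unpair.1.unpair.1), p.2.unpair.1.unpair.2)).bind fun w =>
      (H (Nat.pair p.1.2 (l p.2.unpair.2.unpair.1))).bind fun e =>
        (phi e p.2.unpair.2.unpair.2).map fun q =>
          bif decide (((0 : ℕ) : ℚ) < ratOfNat q) &&
            decide (precTest ((1 : ℕ) / ((p.2.unpair.2.unpair.1 : ℚ) + 1)) (ratOfNat w.unpair.1)
              (ratOfNat w.unpair.2) p.2.unpair.1.unpair.2) then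
            Nat.pair p.1.2 (constCode q) + 1 else 0
  have hV : Partrec V := by
    have i := Computable.snd.comp (Computable.fst (α := ℕ × ℕ) (β := ℕ))
    have s1 := computable_unpair_fst.comp (Computable.snd (α := ℕ × ℕ) (β := ℕ))
    have s2 := computable_unpair_snd.comp (Computable.snd (α := ℕ × ℕ) (β := ℕ))
    have k := computable_unpair_fst.comp s1
    have j := computable_unpair_snd.comp s1
    have m := computable_unpair_fst.comp s2
    have n := computable_unpair_snd.comp s2
    refine Partrec.bind ((Partrec.nat_iff.2 hF).comp i) ?_
    refine Partrec.bind (hT.comp ((((Computable.fst.comp (Computable.fst.comp Computable.fst)).pair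
      Computable.snd).pair (k.comp Computable.fst)).pair (j.comp Computable.fst))) ?_
    refine Partrec.bind ((Partrec.nat_iff.2 hH).comp (computable₂_natPair.comp
      (i.comp (Computable.fst.comp Computable.fst))
      (hlc.comp (m.comp (Computable.fst.comp Computable.fst))))) ?_
    refine Partrec.map (partrec_phi.comp Computable.snd
      (n.comp (Computable.fst.comp (Computable.fst.comp Computable.fst)))) ?_
    have a := Computable.fst.comp (Computable.fst.comp (Computable.fst.comp
      (Computable.fst (α := ((((ℕ × ℕ) × ℕ) × ℕ) × ℕ) × ℕ) (β := ℕ))))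
    have w := Computable.snd.comp (Computable.fst.comp
      (Computable.fst (α := ((((ℕ × ℕ) × ℕ) × ℕ) × ℕ) × ℕ) (β := ℕ)))
    exact Computable.cond (Primrec.and.to_comp.comp
      ((RatComputable.natCast (Computable.const 0)).lt
        (ratComputable_ratOfNat.comp Computable.snd))
      (RatComputable.precTest (RatComputable.div_succ 1 (m.comp a))
        (ratComputable_ratOfNat.comp (computable_unpair_fst.comp w))
        (ratComputable_ratOfNat.comp (computable_unpair_snd.comp w)) (j.comp a)))
      (Computable.succ.comp (computable₂_natPair.comp (i.comp a)
        (computable_constCode.comp Computable.snd))) (Computable.const 0)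
  obtain ⟨S, hS, hSV⟩ := exists_enum hV
  let D : ℕ × ℕ →. ℕ := fun p => (F p.2).bind fun i' => phi p.1.unpair.1 i'
  have hD : Partrec D := Partrec.bind ((Partrec.nat_iff.2 hF).comp Computable.snd)
    (partrec_phi.comp (computable_unpair_fst.comp (Computable.fst.comp Computable.fst))
      Computable.snd)
  obtain ⟨g, hg, hgS⟩ := exists_spreen_code hD
    (Partrec.bind (g := fun w _ => S w) (hD.comp Computable.fst) (hS.comp Computable.fst))
  have hDd : ∀ {p i x O}, SpreenName μ (ballName μ) (ballIncl μ) p O → x ∈ ν i →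
      ((D (p, i)).Dom ↔ f x ∈ O) := by
    intro p i x O hp hx
    obtain ⟨i', hi', hfi⟩ := hFf i x hx
    rw [← hp.1 i' _ hfi]
    simp only [D, Part.eq_some_iff.2 hi', Part.bind_some]
  have hspec : ∀ {p i i' x O}, SpreenName μ (ballName μ) (ballIncl μ) p O → x ∈ ν i → i' ∈ F i →
      f x ∈ μ i' → f x ∈ O → (∀ t, (V ((p, i), t)).Dom) ∧
      ∀ b, (∃ t, b + 1 ∈ V ((p, i), t)) ↔
        ∃ m : ℕ, (∃ v ∈ rad μ p i' (f x), 1 / ((m : ℝ) + 1) < v) ∧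
          ∃ e ∈ H (Nat.pair i (l m)), ∃ n, ∃ q ∈ phi e n, (0 : ℝ) < ratOfNat q ∧
            b = Nat.pair i (constCode q) := by
    intro p i i' x O hp hx hi' hfi hxO
    obtain ⟨δ, hδ, hδ'⟩ := hT' hp hfi hxO
    choose e he hen using fun m => hHφ i x (l m) _ hx (hl m) (hε m)
    choose q hq using fun m => (hen m)
    have hVt : ∀ t, V ((p, i), t) = Part.some (bif decide
        (((0 : ℕ) : ℚ) < ratOfNat (q t.unpair.2.unpair.1 t.unpair.2.unpair.2) ∧
          precTest ((1 : ℕ) / ((t.unpair.2.unpair.1 : ℚ) + 1))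
            (ratOfNat (δ t.unpair.1.unpair.1 t.unpair.1.unpair.2).unpair.1)
            (ratOfNat (δ t.unpair.1.unpair.1 t.unpair.1.unpair.2).unpair.2)
            t.unpair.1.unpair.2) then
        Nat.pair i (constCode (q t.unpair.2.unpair.1 t.unpair.2.unpair.2)) + 1 else 0) := by
      intro t
      simp only [V, Part.eq_some_iff.2 hi', Part.eq_some_iff.2 (hδ _ _),
        Part.eq_some_iff.2 (he _), Part.eq_some_iff.2 ((hq _).1 _), Part.bind_some,
        Part.map_some, Bool.decide_and]
    have hcast : ∀ m : ℕ, (((1 : ℕ) / ((m : ℚ) + 1) : ℚ) : ℝ) = 1 / ((m : ℝ) + 1) := by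
      intro m
      push_cast
      rfl
    refine ⟨fun t => by rw [hVt]; trivial, fun b => ?_⟩
    simp only [hVt, succ_mem_some_bif]
    constructor
    · rintro ⟨t, ⟨h1, h2⟩, rfl⟩
      refine ⟨t.unpair.2.unpair.1, ?_, _, he _, _, _, (hq _).1 _, by exact_mod_cast h1, rfl⟩
      rw [← hcast]
      exact (hδ' _).1 ⟨_, _, h2⟩
    · rintro ⟨m, hm, e', he', n, q', hq', h1, rfl⟩
      obtain rfl := Part.mem_unique he' (he m)
      obtain rfl := Part.mem_unique hq' ((hq m).1 n)
      rw [← hcast] at hm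
      obtain ⟨k, j, hkj⟩ := (hδ' _).2 hm
      refine ⟨Nat.pair (Nat.pair k j) (Nat.pair m n), ?_, by simp⟩
      simp only [Nat.unpair_pair]
      exact ⟨by exact_mod_cast h1, hkj⟩
  have hseq : ∀ {p i i' x O}, SpreenName μ (ballName μ) (ballIncl μ) p O → x ∈ ν i → i' ∈ F i →
      f x ∈ μ i' → f x ∈ O → ∃ s : ℕ → ℕ, (∀ k, s k ∈ phi (g p).unpair.2 (Nat.pair i k)) ∧
        (∀ k, ∃ (m q : ℕ), (∃ v ∈ rad μ p i' (f x), 1 / ((m : ℝ) + 1) < v) ∧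
          (0 : ℝ) < ratOfNat q ∧ ratOfNat q < φ x (1 / ((m : ℝ) + 1)) ∧
          s k = Nat.pair i (constCode q)) ∧
        ∀ m : ℕ, (∃ v ∈ rad μ p i' (f x), 1 / ((m : ℝ) + 1) < v) →
          ∀ z < φ x (1 / ((m : ℝ) + 1)), ∃ k q, z < ratOfNat q ∧
            s k = Nat.pair i (constCode q) := by
    intro p i i' x O hp hx hi' hfi hxO
    obtain ⟨ht, hb⟩ := hspec hp hx hi' hfi hxO
    obtain ⟨d, hd⟩ := Part.dom_iff_mem.1 ((hDd hp hx).2 hxO)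
    have hgood : ∀ m : ℕ, (∃ v ∈ rad μ p i' (f x), 1 / ((m : ℝ) + 1) < v) →
        ∀ z < φ x (1 / ((m : ℝ) + 1)), ∃ q, z < ratOfNat q ∧
          ∃ t, Nat.pair i (constCode q) + 1 ∈ V ((p, i), t) := by
      intro m hm z hz
      obtain ⟨e, he, hen⟩ := hHφ i x (l m) _ hx (hl m) (hε m)
      obtain ⟨n, q, hq, hlt, -⟩ :=
        hen.exists_lt (max_lt hz (hpos x _ ⟨i, hx⟩ ⟨_, hl m⟩ (hε m)))
      exact ⟨q, (le_max_left _ _).trans_lt hlt,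
        (hb _).2 ⟨m, hm, e, he, n, q, hq, (le_max_right _ _).trans_lt hlt, rfl⟩⟩
    obtain ⟨v, hv⟩ := rad_nonempty hp hfi hxO
    obtain ⟨m, hm⟩ := exists_nat_one_div_lt (pos_of_mem_rad hp hfi hxO hv)
    obtain ⟨q, -, t, h⟩ := hgood m ⟨v, hv, hm⟩ _ (sub_one_lt _)
    obtain ⟨s, hs, hs'⟩ := (hSV _ ht).2 ⟨t, _, h⟩
    refine ⟨s, fun k => ?_, fun k => ?_, fun m hm z hz => ?_⟩
    · rw [(hgS p i).2]
      exact Part.mem_bind hd (hs k)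
    · obtain ⟨m, hm, e, he, n, q, hq, h0, hk⟩ := (hb _).1 ((hs' _).1 ⟨k, rfl⟩)
      obtain ⟨e', he', hen⟩ := hHφ i x (l m) _ hx (hl m) (hε m)
      obtain rfl := Part.mem_unique he he'
      exact ⟨m, q, hm, h0, hen.lt_of_mem hq, hk⟩
    · obtain ⟨q, hzq, hq⟩ := hgood m hm z hz
      obtain ⟨k, hk⟩ := (hs' _).2 hq
      exact ⟨k, q, hzq, hk⟩
  have hmono : ∀ {p p' i i' j j' x O O'} {s t : ℕ → ℕ},
      SpreenName μ (ballName μ) (ballIncl μ) p O → SpreenName μ (ballName μ) (ballIncl μ) p' O' →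
      x ∈ ν i → x ∈ ν i' → j ∈ F i → j' ∈ F i' → f x ∈ μ j → f x ∈ μ j' → f x ∈ O → f x ∈ O' →
      (∀ v ∈ rad μ p j (f x), ∃ v' ∈ rad μ p' j' (f x), v ≤ v') →
      (∀ k, s k ∈ phi (g p).unpair.2 (Nat.pair i k)) →
      (∀ k, t k ∈ phi (g p').unpair.2 (Nat.pair i' k)) → SeqIncl₂ (ballIncl ν) s t := by
    intro p p' i i' j j' x O O' s t hp hp' hx hx' hj hj' hfj hfj' hO hO' hdomin hs ht k
    obtain ⟨s', hs', hsb, -⟩ := hseq hp hx hj hfj hO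
    obtain ⟨t', ht', -, htb⟩ := hseq hp' hx' hj' hfj' hO'
    obtain rfl := eq_of_forall_mem hs hs'
    obtain rfl := eq_of_forall_mem ht ht'
    obtain ⟨m, q, ⟨v, hv, hmv⟩, -, hq, hk⟩ := hsb k
    obtain ⟨v', hv', hle⟩ := hdomin v hv
    obtain ⟨k', q', hqq, hk'⟩ := htb m ⟨v', hv', hmv.trans_le hle⟩ _ hq
    refine ⟨k', ?_⟩
    rw [hk, hk']
    exact ⟨x, x, _, _, by simpa using hx, by simpa using hx',
      by simpa using cRealName_constCode q, by simpa using cRealName_constCode q',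
      by simpa using hqq.le⟩
  have hname : ∀ p O, SpreenName μ (ballName μ) (ballIncl μ) p O →
      SpreenName ν (ballName ν) (ballIncl ν) (g p) (f ⁻¹' O) := by
    intro p O hp
    refine ⟨fun i x hx => ?_, fun i x hx hxO => ?_, fun i i' x s t hx hx' hxO hs ht => ?_,
      fun x hxO => ?_⟩
    · rw [(hgS p i).1, hDd hp hx]
      rfl
    · obtain ⟨j, hj, hfj⟩ := hFf i x hx
      obtain ⟨s, hs, hsb, -⟩ := hseq hp hx hj hfj hxO
      refine ⟨s, hs, fun k => ?_⟩
      obtain ⟨m, q, ⟨v, hv, hmv⟩, h0, hq, hk⟩ := hsb k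
      rw [hk]
      refine ⟨_, ballName_constCode hx q, Metric.mem_ball_self h0, fun y hy => ?_⟩
      rw [Metric.mem_ball'] at hy
      exact mem_of_dist_lt_rad hp hfj hxO hv
        ((hest x y _ ⟨i, hx⟩ ⟨_, hl m⟩ (hε m) (hy.trans hq)).trans hmv)
    · obtain ⟨j, hj, hfj⟩ := hFf i x hx
      obtain ⟨j', hj', hfj'⟩ := hFf i' x hx'
      obtain ⟨s', -, -, hs', -⟩ := exists_seq_of_spreenName hp hfj hxO
      obtain ⟨t', -, -, ht', -⟩ := exists_seq_of_spreenName hp hfj' hxO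
      obtain ⟨h1, h2⟩ := hp.2.2.1 j j' _ s' t' hfj hfj' hxO hs' ht'
      exact ⟨hmono hp hp hx hx' hj hj' hfj hfj' hxO hxO
          (fun v hv => exists_le_of_mem_rad h1 hs' ht' hv) hs ht,
        hmono hp hp hx' hx hj' hj hfj' hfj hxO hxO
          (fun v hv => exists_le_of_mem_rad h2 ht' hs' hv) ht hs⟩
    · obtain ⟨δ, hδ, hδ'⟩ := exists_rad_lower_bound hp hxO
      obtain ⟨ρ, hρ, hρf⟩ := Metric.continuous_iff.1 hcont x δ hδ
      obtain ⟨m, hm⟩ := exists_nat_one_div_lt hδ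
      obtain ⟨r, hr, hrφ⟩ := hnv x _ ⟨_, hl m⟩ (hε m)
      obtain ⟨q, hq0, hq⟩ := exists_ratOfNat_btwn
        (lt_min (by linarith : 0 < ρ / 4) (by linarith : 0 < r / 4))
      obtain ⟨n, c, hc, hxc⟩ := hX.exists_dist_lt x hq0
      have hqρ := hq.trans_le (min_le_left _ _)
      have hqr := hq.trans_le (min_le_right _ _)
      refine ⟨_, _, ballName_constCode hc q, hxc, fun i y hy hyB s hs => ?_⟩
      rw [Metric.mem_ball'] at hyB
      have hxy := dist_triangle x c y
      have hfxy : dist (f x) (f y) < δ := by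
        rw [dist_comm]
        exact hρf y (by rw [dist_comm]; linarith)
      have hyO : f y ∈ O := by
        have := Part.dom_iff_mem.2 ⟨_, hs 0⟩
        rw [(hgS p i).2] at this
        exact (hDd hp hy).1 (Part.Dom.of_bind this)
      obtain ⟨j, hj, hfj⟩ := hFf i y hy
      rcases hδ' with hδ' | hδ'
      · exact absurd hyO (hδ' j _ hfj hfxy)
      · obtain ⟨-, v, hv, hδv⟩ := hδ' j _ hfj hfxy
        obtain ⟨s', hs', -, hsb⟩ := hseq hp hy hj hfj hyO
        obtain rfl := eq_of_forall_mem hs hs'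
        have hry := hrφ y (by linarith) ⟨i, hy⟩
        obtain ⟨k, q', hq', hk⟩ := hsb m ⟨v, hv, hm.trans hδv⟩ (r / 2) (by linarith)
        refine ⟨k, ?_⟩
        rw [hk]
        exact ⟨c, y, _, _, by simpa using hc, by simpa using hy,
          by simpa using cRealName_constCode q, by simpa using cRealName_constCode q',
          by linarith⟩
  refine ⟨?_, fun p => Part.some (g p), Partrec.nat_iff.1 hg.partrec,
    fun p O hp => ⟨g p, Part.mem_some _, hname p O hp⟩, ?_⟩
  · rwa [hX.generateFrom_ballName, hY.generateFrom_ballName]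
  · intro p p' O O' hp hp' hincl m₁ hm₁ m₂ hm₂ i hi hdi
    obtain rfl := Part.mem_some_iff.1 hm₁
    obtain rfl := Part.mem_some_iff.1 hm₂
    obtain ⟨x, hx⟩ := Part.dom_iff_mem.1 hi
    obtain ⟨j, hj, hfj⟩ := hFf i x hx
    have hxO : f x ∈ O := ((hname p O hp).1 i x hx).1 hdi
    obtain ⟨h1, h2⟩ := hincl j (Part.dom_iff_mem.2 ⟨_, hfj⟩) ((hp.1 j _ hfj).2 hxO)
    have hxO' : f x ∈ O' := (hp'.1 j _ hfj).1 h1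
    obtain ⟨s', -, -, hs', -⟩ := exists_seq_of_spreenName hp hfj hxO
    obtain ⟨t', -, -, ht', -⟩ := exists_seq_of_spreenName hp' hfj hxO'
    exact ⟨((hname p' O' hp').1 i x hx).2 hxO', fun s t hs ht =>
      hmono hp hp' hx hx hj hj hfj hfj hxO hxO'
        (fun v hv => exists_le_of_mem_rad (h2 s' t' hs' ht') hs' ht' hv) hs ht⟩

end Equivalence

/-- For a `(ν,μ)`-computable function between computable metric
spaces*, formal effective metric continuity is equivalent to effective continuity
with respect to the Spreen topologies induced by the metrics (generated by the
open balls viewed as Spreen bases with their natural formal inclusions). -/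
theorem formalEffMetricCont_iff_effContinuous_spreen
    {X Y : Type*} [MetricSpace X] [MetricSpace Y]
    (ν : ℕ →. X) (μ : ℕ →. Y) (hX : IsCMS ν) (hY : IsCMS μ)
    (f : X → Y) (hf : Computes ν μ f) :
    FormalEffMetricCont ν f ↔
      EffContinuousF (TopologicalSpace.generateFrom {B | ∃ b, ballName ν b B})
        (TopologicalSpace.generateFrom {B | ∃ b, ballName μ b B})
        (SpreenName ν (ballName ν) (ballIncl ν))
        (SpreenName μ (ballName μ) (ballIncl μ))
        (SpreenTauIncl ν (ballIncl ν)) (SpreenTauIncl μ (ballIncl μ)) f := by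
  exact ⟨fun h => h.effContinuousF hX hY hf, formalEffMetricCont_of_effContinuousF hX hY hf⟩

end T1
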